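/- arXiv:1311.3043 — 4 statements merged into one kernel-verified Lean document; each statement's English description precedes it below -/
import Mathlib

section
/- For |q| < 1, Σ_{n≥0} (1/(−q;q)_n − 1/(−q;q)_∞) = 2 Σ_{n≥1} (−1)^{n−1} q^{n^2}/(q;q^2)_n − (1/(−q;q)_∞) · Σ_{n≥1} q^n/(1−q^n). -/
open Finset Filter Topology

/-- The finite product `(q; q)_n`. -/
noncomputable def eulerProd (q : ℂ) (n : ℕ) : ℂ := ∏ k ∈ range n, (1 - q ^ (k + 1))

@[simp] lemma eulerProd_zero (q : ℂ) : eulerProd q 0 = 1 := by simp [eulerProd]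

lemma eulerProd_succ (q : ℂ) (n : ℕ) :
    eulerProd q (n + 1) = eulerProd q n * (1 - q ^ (n + 1)) := prod_range_succ _ _

lemma pow_succ_ne_one {q : ℂ} (hq : ‖q‖ < 1) (n : ℕ) : q ^ (n + 1) ≠ 1 := fun h => by
  have := pow_lt_one₀ (norm_nonneg q) hq (Nat.succ_ne_zero n)
  rw [← norm_pow, h, norm_one] at this
  exact lt_irrefl _ this

lemma one_sub_pow_succ_ne_zero {q : ℂ} (hq : ‖q‖ < 1) (n : ℕ) : 1 - q ^ (n + 1) ≠ 0 :=
  sub_ne_zero.2 (pow_succ_ne_one hq n).symm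

lemma eulerProd_ne_zero {q : ℂ} (hq : ‖q‖ < 1) (n : ℕ) : eulerProd q n ≠ 0 :=
  prod_ne_zero_iff.2 fun k _ => one_sub_pow_succ_ne_zero hq k

lemma summable_mul_pow {q : ℂ} (hq : ‖q‖ < 1) (x : ℂ) : Summable fun k : ℕ => ‖x * q ^ k‖ := by
  simpa [norm_mul, norm_pow] using
    (summable_geometric_of_lt_one (norm_nonneg q) hq).mul_left ‖x‖

lemma multipliable_one_add_mul_pow {q : ℂ} (hq : ‖q‖ < 1) (x : ℂ) :
    Multipliable fun k : ℕ => 1 + x * q ^ k :=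
  multipliable_one_add_of_summable (summable_mul_pow hq x)

lemma exists_tendsto_eulerProd {q : ℂ} (hq : ‖q‖ < 1) :
    ∃ l : ℂ, l ≠ 0 ∧ Tendsto (eulerProd q) atTop (𝓝 l) := by
  have e (k : ℕ) : 1 + -q * q ^ k = 1 - q ^ (k + 1) := by ring
  refine ⟨∏' k : ℕ, (1 + -q * q ^ k), ?_, ?_⟩
  · refine tprod_one_add_ne_zero_of_summable (fun k => ?_) (summable_mul_pow hq _)
    rw [e]
    exact one_sub_pow_succ_ne_zero hq k
  · refine (multipliable_one_add_mul_pow hq (-q)).hasProd.tendsto_prod_nat.congr fun n => ?_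
    simp only [e, eulerProd]

lemma exists_norm_le_of_tendsto {u : ℕ → ℂ} {l : ℂ} (h : Tendsto u atTop (𝓝 l)) :
    ∃ C : ℝ, 0 ≤ C ∧ ∀ n, ‖u n‖ ≤ C := by
  obtain ⟨C, hC⟩ := (Metric.isBounded_range_of_tendsto u h).exists_norm_le
  exact ⟨C, (norm_nonneg _).trans (hC _ ⟨0, rfl⟩), fun n => hC _ ⟨n, rfl⟩⟩

lemma exists_norm_eulerProd_le {q : ℂ} (hq : ‖q‖ < 1) :
    ∃ C : ℝ, 0 ≤ C ∧ ∀ n, ‖eulerProd q n‖ ≤ C := by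
  obtain ⟨l, _, h⟩ := exists_tendsto_eulerProd hq
  exact exists_norm_le_of_tendsto h

lemma exists_norm_inv_eulerProd_le {q : ℂ} (hq : ‖q‖ < 1) :
    ∃ C : ℝ, 0 ≤ C ∧ ∀ n, ‖(eulerProd q n)⁻¹‖ ≤ C := by
  obtain ⟨l, hl, h⟩ := exists_tendsto_eulerProd hq
  exact exists_norm_le_of_tendsto (h.inv₀ hl)

lemma exists_norm_inv_one_sub_pow_le {q : ℂ} (hq : ‖q‖ < 1) :
    ∃ C : ℝ, 0 ≤ C ∧ ∀ n : ℕ, ‖(1 - q ^ (n + 1))⁻¹‖ ≤ C := by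
  have h : Tendsto (fun n : ℕ => (1 - q ^ (n + 1))⁻¹) atTop (𝓝 (1 - 0)⁻¹) :=
    (tendsto_const_nhds.sub
      ((tendsto_add_atTop_iff_nat 1).2 (tendsto_pow_atTop_nhds_zero_of_norm_lt_one hq))).inv₀
      (by simp)
  exact exists_norm_le_of_tendsto h

/-- The terms of Euler's expansion of `(-x; q)_∞`. -/
noncomputable def eulerTerm (q x : ℂ) (k : ℕ) : ℂ := q ^ k.choose 2 * x ^ k / eulerProd q k

lemma exists_norm_eulerTerm_le {q : ℂ} (hq : ‖q‖ < 1) :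
    ∃ C : ℝ, 0 ≤ C ∧ ∀ x k, ‖eulerTerm q x k‖ ≤ C * ‖x‖ ^ k := by
  obtain ⟨C, hC, h⟩ := exists_norm_inv_eulerProd_le hq
  refine ⟨C, hC, fun x k => ?_⟩
  rw [eulerTerm, div_eq_mul_inv, norm_mul, norm_mul, norm_pow, norm_pow, mul_comm]
  have h1 : ‖q‖ ^ k.choose 2 ≤ 1 := pow_le_one₀ (norm_nonneg _) hq.le
  have h2 : ‖q‖ ^ k.choose 2 * ‖x‖ ^ k ≤ ‖x‖ ^ k := mul_le_of_le_one_left (by positivity) h1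
  exact mul_le_mul (h k) h2 (by positivity) hC

lemma summable_eulerTerm {q x : ℂ} (hq : ‖q‖ < 1) (hx : ‖x‖ < 1) :
    Summable (eulerTerm q x) := by
  obtain ⟨C, _, h⟩ := exists_norm_eulerTerm_le hq
  exact .of_norm_bounded ((summable_geometric_of_lt_one (norm_nonneg x) hx).mul_left C) (h x)

lemma tsum_eulerTerm_eq_mul {q x : ℂ} (hq : ‖q‖ < 1) (hx : ‖x‖ < 1) :
    ∑' k, eulerTerm q x k = (1 + x) * ∑' k, eulerTerm q (x * q) k := by
  have hxq : ‖x * q‖ < 1 := by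
    rw [norm_mul]; exact mul_lt_one_of_nonneg_of_lt_one_left (norm_nonneg _) hx hq.le
  have s1 := summable_eulerTerm hq hx
  have s2 := summable_eulerTerm hq hxq
  have key (k : ℕ) : eulerTerm q x (k + 1) =
      eulerTerm q (x * q) (k + 1) + x * eulerTerm q (x * q) k := by
    have h1 := eulerProd_ne_zero hq k
    have h2 := one_sub_pow_succ_ne_zero hq k
    simp only [eulerTerm, eulerProd_succ, Nat.choose_succ_succ' k 1, Nat.choose_one_right]
    field_simp
    ring
  rw [s1.tsum_eq_zero_add, add_mul, one_mul, s2.tsum_eq_zero_add, add_assoc,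
    ← s2.tsum_eq_zero_add, ← tsum_mul_left,
    ← ((summable_nat_add_iff 1).2 s2).tsum_add (s2.mul_left x)]
  simp only [key]
  simp [eulerTerm]

/-- Euler's expansion `(-x; q)_∞ = ∑ q ^ (k choose 2) x ^ k / (q; q)_k`. -/
lemma tprod_one_add_mul_pow {q x : ℂ} (hq : ‖q‖ < 1) (hx : ‖x‖ < 1) :
    ∏' k : ℕ, (1 + x * q ^ k) = ∑' k, eulerTerm q x k := by
  have hxn (n : ℕ) : ‖x * q ^ n‖ ≤ ‖x‖ := by
    rw [norm_mul, norm_pow]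
    exact mul_le_of_le_one_right (norm_nonneg _) (pow_le_one₀ (norm_nonneg _) hq.le)
  have iter (n : ℕ) : ∑' k, eulerTerm q x k =
      (∏ k ∈ range n, (1 + x * q ^ k)) * ∑' k, eulerTerm q (x * q ^ n) k := by
    induction n with
    | zero => simp
    | succ n ih =>
      rw [ih, tsum_eulerTerm_eq_mul hq ((hxn n).trans_lt hx), prod_range_succ, pow_succ, mul_assoc,
        mul_assoc]
  obtain ⟨C, hC, h⟩ := exists_norm_eulerTerm_le hq
  have lim : Tendsto (fun n : ℕ => ∑' k, eulerTerm q (x * q ^ n) k) atTop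
      (𝓝 (∑' k, if k = 0 then 1 else 0)) := by
    refine tendsto_tsum_of_dominated_convergence
      ((summable_geometric_of_lt_one (norm_nonneg x) hx).mul_left C) (fun k => ?_)
      (.of_forall fun n k => (h _ k).trans ?_)
    · have h0 : Tendsto (fun n : ℕ => x * q ^ n) atTop (𝓝 0) := by
        simpa using (tendsto_pow_atTop_nhds_zero_of_norm_lt_one hq).const_mul x
      have := ((h0.pow k).const_mul (q ^ k.choose 2)).div_const (eulerProd q k)
      rcases k with _ | k
      · simp [eulerTerm]
      · simpa [eulerTerm] using this
    · gcongr
      exact hxn n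
  rw [tsum_ite_eq] at lim
  have := (multipliable_one_add_mul_pow hq x).hasProd.tendsto_prod_nat.mul lim
  rw [mul_one] at this
  exact tendsto_nhds_unique this (tendsto_const_nhds.congr iter)

lemma norm_pow_succ_pow_succ_le {q : ℂ} (hq : ‖q‖ < 1) (n k : ℕ) :
    ‖(q ^ (n + 1)) ^ (k + 1)‖ ≤ ‖q‖ ^ n * ‖q‖ ^ k := by
  rw [← pow_mul, norm_pow, ← pow_add]
  exact pow_le_pow_of_le_one (norm_nonneg _) hq.le (by nlinarith)

lemma summable_geometric_prod {r : ℝ} (h0 : 0 ≤ r) (h1 : r < 1) (C : ℝ) :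
    Summable fun x : ℕ × ℕ => C * (r ^ x.1 * r ^ x.2) :=
  ((summable_geometric_of_lt_one h0 h1).mul_of_nonneg (summable_geometric_of_lt_one h0 h1)
    (fun _ => by positivity) fun _ => by positivity).mul_left C

lemma tsum_sub_succ {u : ℕ → ℂ} (h : Summable fun n => u n - u (n + 1))
    (hu : Tendsto u atTop (𝓝 0)) : ∑' n, (u n - u (n + 1)) = u 0 := by
  refine tendsto_nhds_unique h.hasSum.tendsto_sum_nat ?_
  simp only [sum_range_sub']
  simpa using tendsto_const_nhds.sub hu

/-- The terms of the double series whose two iterated sums are the two sides of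
`tsum_lambert`. -/
noncomputable def lambertTerm (q : ℂ) (n k : ℕ) : ℂ :=
  (-1) ^ k * q ^ (k + 1).choose 2 * (q ^ (n + 1)) ^ (k + 1) * eulerProd q n /
    eulerProd q (n + k + 2)

lemma summable_lambertTerm {q : ℂ} (hq : ‖q‖ < 1) :
    Summable fun x : ℕ × ℕ => lambertTerm q x.1 x.2 := by
  obtain ⟨C, hC, h⟩ := exists_norm_inv_eulerProd_le hq
  obtain ⟨D, hD, h'⟩ := exists_norm_eulerProd_le hq
  refine .of_norm_bounded (summable_geometric_prod (norm_nonneg q) hq (D * C)) fun x => ?_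
  have h1 : ‖q ^ (x.2 + 1).choose 2‖ ≤ 1 := by
    rw [norm_pow]; exact pow_le_one₀ (norm_nonneg _) hq.le
  have h2 := norm_pow_succ_pow_succ_le hq x.1 x.2
  rw [lambertTerm, div_eq_mul_inv, norm_mul, norm_mul, norm_mul, norm_mul, norm_pow, norm_neg,
    norm_one, one_pow, one_mul]
  calc _ ≤ 1 * (‖q‖ ^ x.1 * ‖q‖ ^ x.2) * D * C := by
        gcongr
        exacts [h' _, h _]
    _ = _ := by ring

lemma tendsto_zero_of_norm_le_mul_pow {q : ℂ} (hq : ‖q‖ < 1) {v : ℕ → ℂ} {C : ℝ}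
    (hv : ∀ n, ‖v n‖ ≤ C * ‖q‖ ^ n) : Tendsto v atTop (𝓝 0) := by
  refine squeeze_zero_norm hv ?_
  simpa using (tendsto_pow_atTop_nhds_zero_of_lt_one (norm_nonneg q) hq).const_mul C

lemma tsum_lambertTerm_right {q : ℂ} (hq : ‖q‖ < 1) (n : ℕ) :
    ∑' k, lambertTerm q n k = q ^ (n + 1) / (1 - q ^ (n + 1)) := by
  have hs : Summable fun k => lambertTerm q n k := (summable_lambertTerm hq).prod_factor n
  set r : ℕ → ℂ := fun k => q ^ (n + 1) / (1 - q ^ (n + 1)) *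
    ((-1) ^ k * q ^ (k + 1).choose 2 * (q ^ (n + 1)) ^ k * eulerProd q (n + 1) /
      eulerProd q (n + 1 + k)) with hr
  have key (k : ℕ) : lambertTerm q n k = r k - r (k + 1) := by
    have h1 := eulerProd_ne_zero hq n
    have h2 := eulerProd_ne_zero hq (n + 1 + k)
    have h3 := one_sub_pow_succ_ne_zero hq n
    have h4 := one_sub_pow_succ_ne_zero hq (n + 1 + k)
    have e : n + k + 2 = n + 1 + k + 1 := by ring
    have e' : (k + 1 + 1).choose 2 = k + 1 + (k + 1).choose 2 := by
      rw [Nat.choose_succ_succ' (k + 1) 1, Nat.choose_one_right]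
    simp only [hr, lambertTerm, e, ← add_assoc, eulerProd_succ q (n + 1 + k), eulerProd_succ q n, e']
    field_simp
    ring
  simp only [key] at hs ⊢
  rw [tsum_sub_succ hs]
  · have h1 := eulerProd_ne_zero hq (n + 1)
    simp [hr, h1]
  · obtain ⟨C, hC, h⟩ := exists_norm_inv_eulerProd_le hq
    refine tendsto_zero_of_norm_le_mul_pow hq
      (C := ‖q ^ (n + 1) / (1 - q ^ (n + 1))‖ * ‖eulerProd q (n + 1)‖ * C) fun k => ?_
    have h1 : ‖q ^ (k + 1).choose 2‖ ≤ 1 := by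
      rw [norm_pow]; exact pow_le_one₀ (norm_nonneg _) hq.le
    have h2 : ‖(q ^ (n + 1)) ^ k‖ ≤ ‖q‖ ^ k := by
      rw [← pow_mul, norm_pow]
      exact pow_le_pow_of_le_one (norm_nonneg _) hq.le (by nlinarith)
    simp only [hr]
    rw [norm_mul, div_eq_mul_inv _ (eulerProd q (n + 1 + k)), norm_mul, norm_mul, norm_mul,
      norm_mul, norm_pow (-1 : ℂ), norm_neg, norm_one, one_pow, one_mul]
    calc _ ≤ ‖q ^ (n + 1) / (1 - q ^ (n + 1))‖ *
            (1 * ‖q‖ ^ k * ‖eulerProd q (n + 1)‖ * C) := by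
          gcongr
          exact h _
      _ = _ := by ring

lemma tsum_lambertTerm_left {q : ℂ} (hq : ‖q‖ < 1) (k : ℕ) :
    ∑' n, lambertTerm q n k = (-1) ^ k * (eulerTerm q q (k + 1) / (1 - q ^ (k + 1))) := by
  have hs : Summable fun n => lambertTerm q n k := (summable_lambertTerm hq).prod_symm.prod_factor k
  set r : ℕ → ℂ := fun n => (-1) ^ k * q ^ (k + 1).choose 2 / (1 - q ^ (k + 1)) *
    ((q ^ (n + 1)) ^ (k + 1) * eulerProd q n / eulerProd q (n + k + 1)) with hr
  have key (n : ℕ) : lambertTerm q n k = r n - r (n + 1) := by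
    have h1 := eulerProd_ne_zero hq n
    have h2 := eulerProd_ne_zero hq (n + k + 1)
    have h3 := one_sub_pow_succ_ne_zero hq k
    have h4 := one_sub_pow_succ_ne_zero hq (n + k + 1)
    have e : n + 1 + k + 1 = n + k + 1 + 1 := by ring
    have e2 : n + k + 2 = n + k + 1 + 1 := by ring
    simp only [hr, lambertTerm, e, e2, eulerProd_succ q (n + k + 1), eulerProd_succ q n]
    field_simp
    ring
  simp only [key] at hs ⊢
  rw [tsum_sub_succ hs]
  · simp only [hr, eulerTerm, eulerProd_zero, zero_add, pow_one, mul_one]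
    ring
  · obtain ⟨C, hC, h⟩ := exists_norm_inv_eulerProd_le hq
    obtain ⟨D, hD, h'⟩ := exists_norm_eulerProd_le hq
    refine tendsto_zero_of_norm_le_mul_pow hq
      (C := ‖(-1) ^ k * q ^ (k + 1).choose 2 / (1 - q ^ (k + 1))‖ * D * C) fun n => ?_
    have h2 : ‖(q ^ (n + 1)) ^ (k + 1)‖ ≤ ‖q‖ ^ n := by
      rw [← pow_mul, norm_pow]
      exact pow_le_pow_of_le_one (norm_nonneg _) hq.le (by nlinarith)
    simp only [hr]
    rw [norm_mul, div_eq_mul_inv _ (eulerProd q (n + k + 1)), norm_mul, norm_mul]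
    calc _ ≤ ‖(-1) ^ k * q ^ (k + 1).choose 2 / (1 - q ^ (k + 1))‖ * (‖q‖ ^ n * D * C) := by
          gcongr
          exacts [h' _, h _]
      _ = _ := by ring

/-- Uchimura's identity, with the signs `(-1) ^ k` on the right. -/
lemma tsum_lambert {q : ℂ} (hq : ‖q‖ < 1) :
    ∑' n : ℕ, q ^ (n + 1) / (1 - q ^ (n + 1)) =
      ∑' k, (-1) ^ k * (eulerTerm q q (k + 1) / (1 - q ^ (k + 1))) := by
  simp only [← tsum_lambertTerm_right hq, ← tsum_lambertTerm_left hq]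
  exact (Summable.tsum_comm (f := lambertTerm q) (summable_lambertTerm hq)).symm

lemma summable_eulerTerm_div {q : ℂ} (hq : ‖q‖ < 1) :
    Summable fun k => eulerTerm q q (k + 1) / (1 - q ^ (k + 1)) := by
  obtain ⟨C, hC, h⟩ := exists_norm_eulerTerm_le hq
  obtain ⟨D, hD, h'⟩ := exists_norm_inv_one_sub_pow_le hq
  refine .of_norm_bounded (((summable_geometric_of_lt_one (norm_nonneg q) hq).mul_left
    (C * ‖q‖ * D))) fun k => ?_
  rw [div_eq_mul_inv, norm_mul]
  calc _ ≤ C * ‖q‖ ^ (k + 1) * D := by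
        gcongr
        exacts [h _ _, h' _]
    _ = _ := by ring

lemma tsum_tprod_sub_one {q : ℂ} (hq : ‖q‖ < 1) :
    ∑' n : ℕ, (∏' k : ℕ, (1 + q ^ (n + 1) * q ^ k) - 1) =
      ∑' k, eulerTerm q q (k + 1) / (1 - q ^ (k + 1)) := by
  have hn (n : ℕ) : ‖q ^ (n + 1)‖ < 1 := by
    rw [norm_pow]; exact pow_lt_one₀ (norm_nonneg _) hq n.succ_ne_zero
  have h1 (n : ℕ) : ∏' k : ℕ, (1 + q ^ (n + 1) * q ^ k) - 1 =
      ∑' k, eulerTerm q (q ^ (n + 1)) (k + 1) := by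
    rw [tprod_one_add_mul_pow hq (hn n), (summable_eulerTerm hq (hn n)).tsum_eq_zero_add]
    simp [eulerTerm]
  have h2 (k : ℕ) : ∑' n, eulerTerm q (q ^ (n + 1)) (k + 1) =
      eulerTerm q q (k + 1) / (1 - q ^ (k + 1)) := by
    have e (n : ℕ) : eulerTerm q (q ^ (n + 1)) (k + 1) =
        eulerTerm q q (k + 1) * (q ^ (k + 1)) ^ n := by
      simp only [eulerTerm]
      ring
    simp only [e]
    rw [tsum_mul_left, tsum_geometric_of_norm_lt_one (hn k), div_eq_mul_inv]
  simp only [h1, ← h2]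
  obtain ⟨C, hC, h⟩ := exists_norm_eulerTerm_le hq
  refine Summable.tsum_comm (f := fun k n => eulerTerm q (q ^ (n + 1)) (k + 1)) ?_
  refine .of_norm_bounded (summable_geometric_prod (norm_nonneg q) hq C) fun x => ?_
  refine (h _ _).trans ?_
  rw [← norm_pow, mul_comm (‖q‖ ^ x.1)]
  gcongr
  exact norm_pow_succ_pow_succ_le hq _ _

/-- The finite product `(q; q²)_n`. -/
noncomputable def oddProd (q : ℂ) (n : ℕ) : ℂ := ∏ k ∈ range n, (1 - q ^ (2 * k + 1))

lemma oddProd_succ (q : ℂ) (n : ℕ) :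
    oddProd q (n + 1) = oddProd q n * (1 - q ^ (2 * n + 1)) := prod_range_succ _ _

lemma oddProd_ne_zero {q : ℂ} (hq : ‖q‖ < 1) (n : ℕ) : oddProd q n ≠ 0 :=
  prod_ne_zero_iff.2 fun k _ => one_sub_pow_succ_ne_zero hq (2 * k)

lemma eulerProd_two_mul (q : ℂ) (n : ℕ) :
    eulerProd q (2 * n) = eulerProd (q ^ 2) n * oddProd q n := by
  induction n with
  | zero => simp [oddProd]
  | succ n ih =>
    rw [mul_add, mul_one, eulerProd_succ q (2 * n + 1), eulerProd_succ q (2 * n), ih,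
      eulerProd_succ, oddProd_succ]
    ring

lemma prod_one_add_mul_eulerProd (q : ℂ) (n : ℕ) :
    (∏ k ∈ range n, (1 + q ^ (k + 1))) * eulerProd q n = eulerProd (q ^ 2) n := by
  rw [eulerProd, eulerProd, ← prod_mul_distrib]
  exact prod_congr rfl fun k _ => by ring

lemma multipliable_one_add_pow_succ {q : ℂ} (hq : ‖q‖ < 1) :
    Multipliable fun k : ℕ => 1 + q ^ (k + 1) := by
  simpa only [pow_succ'] using multipliable_one_add_mul_pow hq q

lemma norm_sq_lt_one {q : ℂ} (hq : ‖q‖ < 1) : ‖q ^ 2‖ < 1 := by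
  rw [norm_pow]; exact pow_lt_one₀ (norm_nonneg _) hq two_ne_zero

lemma multipliable_one_sub_odd_pow {q : ℂ} (hq : ‖q‖ < 1) (n : ℕ) :
    Multipliable fun k : ℕ => 1 - q ^ (2 * (k + n) + 1) := by
  refine (multipliable_one_add_mul_pow (norm_sq_lt_one hq) (-q ^ (2 * n + 1))).congr fun k => ?_
  ring

/-- Euler's identity `(-q; q)_∞ (q; q²)_∞ = 1`. -/
lemma tprod_one_add_pow_mul_tprod_one_sub_odd_pow {q : ℂ} (hq : ‖q‖ < 1) :
    (∏' k : ℕ, (1 + q ^ (k + 1))) * ∏' k : ℕ, (1 - q ^ (2 * k + 1)) = 1 := by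
  obtain ⟨l, hl, h⟩ := exists_tendsto_eulerProd hq
  have h1 := (multipliable_one_add_pow_succ hq).hasProd.tendsto_prod_nat.mul
    (multipliable_one_sub_odd_pow hq 0).hasProd.tendsto_prod_nat
  have h2 : Tendsto (fun n => eulerProd q (2 * n) / eulerProd q n) atTop (𝓝 (l / l)) :=
    (h.comp (tendsto_id.const_mul_atTop' two_pos)).div h hl
  rw [div_self hl] at h2
  refine tendsto_nhds_unique h1 (h2.congr fun n => ?_)
  rw [div_eq_iff (eulerProd_ne_zero hq n), eulerProd_two_mul, ← prod_one_add_mul_eulerProd]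
  simp only [oddProd, add_zero]
  ring

lemma sum_antidiagonal_eq_zero {p : ℂ} (hp : ‖p‖ < 1) (n : ℕ) :
    ∑ x ∈ antidiagonal (n + 1),
      (-1) ^ x.1 * p ^ x.1.choose 2 / (eulerProd p x.1 * eulerProd p x.2) = 0 := by
  have h0 := eulerProd_ne_zero hp
  have h1 := one_sub_pow_succ_ne_zero hp
  refine (mul_eq_zero.1 (?_ : (1 - p ^ (n + 1)) * _ = 0)).resolve_left (h1 n)
  have key : ∀ x ∈ antidiagonal (n + 1),
      (1 - p ^ (n + 1)) * ((-1) ^ x.1 * p ^ x.1.choose 2 / (eulerProd p x.1 * eulerProd p x.2)) =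
      (1 - p ^ x.1) * ((-1) ^ x.1 * p ^ x.1.choose 2 / (eulerProd p x.1 * eulerProd p x.2)) +
      p ^ x.1 * (1 - p ^ x.2) *
        ((-1) ^ x.1 * p ^ x.1.choose 2 / (eulerProd p x.1 * eulerProd p x.2)) := by
    intro x hx
    rw [← mem_antidiagonal.1 hx]
    ring
  rw [mul_sum, sum_congr rfl key, sum_add_distrib, Nat.sum_antidiagonal_succ,
    Nat.sum_antidiagonal_succ', pow_zero, sub_self, zero_mul, zero_add, mul_zero, zero_mul,
    zero_add, ← sum_add_distrib]
  refine sum_eq_zero fun x _ => ?_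
  have a1 := h0 x.1
  have a2 := h0 x.2
  have a3 := h1 x.1
  have a4 := h1 x.2
  simp only [eulerProd_succ, Nat.choose_succ_succ' x.1 1, Nat.choose_one_right]
  field_simp
  ring

/-- The partial fraction decomposition of `1 / (a; p)_{n+1}`. -/
lemma sum_antidiagonal_partial_fraction {p a : ℂ} (hp : ‖p‖ < 1) (ha : ∀ k : ℕ, 1 - a * p ^ k ≠ 0)
    (n : ℕ) :
    ∑ x ∈ antidiagonal n, (-1) ^ x.1 * p ^ (x.1 + 1).choose 2 /
      (eulerProd p x.1 * eulerProd p x.2 * (1 - a * p ^ x.1)) =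
    (∏ k ∈ range (n + 1), (1 - a * p ^ k))⁻¹ := by
  have h0 := eulerProd_ne_zero hp
  have h1 := one_sub_pow_succ_ne_zero hp
  induction n with
  | zero => simp
  | succ n ih =>
    rw [prod_range_succ, mul_inv, ← ih, ← div_eq_mul_inv, eq_div_iff (ha _), mul_comm, mul_sum]
    have key : ∀ x ∈ antidiagonal (n + 1),
        (1 - a * p ^ (n + 1)) * ((-1) ^ x.1 * p ^ (x.1 + 1).choose 2 /
          (eulerProd p x.1 * eulerProd p x.2 * (1 - a * p ^ x.1))) =
        (1 - p ^ x.2) * ((-1) ^ x.1 * p ^ (x.1 + 1).choose 2 /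
          (eulerProd p x.1 * eulerProd p x.2 * (1 - a * p ^ x.1))) +
        p ^ (n + 1) * ((-1) ^ x.1 * p ^ x.1.choose 2 / (eulerProd p x.1 * eulerProd p x.2)) := by
      intro x hx
      have a1 := h0 x.1
      have a2 := h0 x.2
      have a3 := ha x.1
      rw [← mem_antidiagonal.1 hx, Nat.choose_succ_succ' x.1 1, Nat.choose_one_right]
      field_simp
      ring
    rw [sum_congr rfl key, sum_add_distrib, ← mul_sum, sum_antidiagonal_eq_zero hp,
      Nat.sum_antidiagonal_succ', pow_zero, sub_self, zero_mul, zero_add, mul_zero, add_zero]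
    refine sum_congr rfl fun x _ => ?_
    have a1 := h0 x.1
    have a2 := h0 x.2
    have a3 := ha x.1
    have a4 := h1 x.2
    simp only [eulerProd_succ]
    field_simp

lemma tsum_prod_eq_tsum_antidiagonal {f : ℕ × ℕ → ℂ} (hf : Summable f) :
    ∑' j, ∑' s, f (j, s) = ∑' n, ∑ x ∈ antidiagonal n, f x := by
  rw [← hf.tsum_prod, ← HasAntidiagonal.sigmaAntidiagonalEquivProd.tsum_eq f]
  conv_rhs => congr; ext; rw [← Finset.sum_finset_coe, ← tsum_fintype (L := .unconditional _)]
  exact (HasAntidiagonal.sigmaAntidiagonalEquivProd.summable_iff.2 hf).tsum_sigma'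
    fun n => (hasSum_fintype _).summable

lemma two_mul_choose_two_add (n : ℕ) : 2 * n.choose 2 + n = n ^ 2 := by
  induction n with
  | zero => rfl
  | succ n ih =>
    rw [Nat.choose_succ_succ' n 1, Nat.choose_one_right]
    nlinarith

/-- The terms of the double series whose iterated sum and antidiagonal sum are the two sides of
`tsum_eulerTerm_div_even`. -/
noncomputable def oddTerm (q : ℂ) (x : ℕ × ℕ) : ℂ :=
  q ^ ((2 * x.1 + 1) * (x.1 + 1)) / (eulerProd (q ^ 2) x.1 * (1 - q ^ (2 * x.1 + 1))) *
    eulerTerm (q ^ 2) (-q ^ (2 * (x.1 + 1) + 1)) x.2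

lemma summable_oddTerm {q : ℂ} (hq : ‖q‖ < 1) : Summable (oddTerm q) := by
  obtain ⟨C, hC, h⟩ := exists_norm_eulerTerm_le (norm_sq_lt_one hq)
  obtain ⟨D, hD, h'⟩ := exists_norm_inv_eulerProd_le (norm_sq_lt_one hq)
  obtain ⟨B, hB, h''⟩ := exists_norm_inv_one_sub_pow_le hq
  refine .of_norm_bounded (summable_geometric_prod (norm_nonneg q) hq (D * B * C)) fun x => ?_
  have h1 : ‖q ^ ((2 * x.1 + 1) * (x.1 + 1))‖ ≤ ‖q‖ ^ x.1 := by
    rw [norm_pow]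
    exact pow_le_pow_of_le_one (norm_nonneg _) hq.le (by nlinarith)
  have h2 : ‖-q ^ (2 * (x.1 + 1) + 1)‖ ^ x.2 ≤ ‖q‖ ^ x.2 := by
    rw [norm_neg, norm_pow]
    gcongr
    exact pow_le_of_le_one (norm_nonneg _) hq.le (by omega)
  rw [oddTerm, div_eq_mul_inv, mul_inv, norm_mul, norm_mul, norm_mul]
  calc _ ≤ ‖q‖ ^ x.1 * (D * B) * (C * ‖q‖ ^ x.2) := by
        gcongr
        exacts [h' _, h'' _, (h _ _).trans (by gcongr)]
    _ = _ := by ring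

lemma sum_antidiagonal_oddTerm {q : ℂ} (hq : ‖q‖ < 1) (n : ℕ) :
    ∑ x ∈ antidiagonal n, oddTerm q x =
      (-1) ^ n * q ^ ((n + 1) ^ 2) / oddProd q (n + 1) := by
  have e (k : ℕ) : 1 - q * (q ^ 2) ^ k = 1 - q ^ (2 * k + 1) := by ring
  have pf := sum_antidiagonal_partial_fraction (norm_sq_lt_one hq) (a := q)
    (fun k => by rw [e]; exact one_sub_pow_succ_ne_zero hq (2 * k)) n
  simp only [e] at pf
  rw [oddProd, div_eq_mul_inv, ← pf, mul_sum]
  refine sum_congr rfl fun x hx => ?_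
  have e1 : q ^ ((2 * x.1 + 1) * (x.1 + 1)) *
      ((q ^ 2) ^ x.2.choose 2 * (q ^ (2 * (x.1 + 1) + 1)) ^ x.2) =
      q ^ ((n + 1) ^ 2) * (q ^ 2) ^ (x.1 + 1).choose 2 := by
    simp only [← pow_mul, ← pow_add]
    congr 1
    rw [← mem_antidiagonal.1 hx]
    nlinarith [two_mul_choose_two_add x.2, two_mul_choose_two_add (x.1 + 1)]
  have e2 : (-1 : ℂ) ^ n * (-1) ^ x.1 = (-1) ^ x.2 := by
    rw [← mem_antidiagonal.1 hx, pow_add, mul_right_comm, ← mul_pow]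
    simp
  calc oddTerm q x = q ^ ((2 * x.1 + 1) * (x.1 + 1)) *
        ((q ^ 2) ^ x.2.choose 2 * (q ^ (2 * (x.1 + 1) + 1)) ^ x.2) * (-1) ^ x.2 /
        (eulerProd (q ^ 2) x.1 * eulerProd (q ^ 2) x.2 * (1 - q ^ (2 * x.1 + 1))) := by
        rw [oddTerm, eulerTerm, neg_pow, div_mul_div_comm]
        congr 1 <;> ring
    _ = _ := by
        rw [e1, ← e2]
        ring

lemma tsum_eulerTerm_div_even {q : ℂ} (hq : ‖q‖ < 1) :
    (∏' k : ℕ, (1 - q ^ (2 * k + 1))) *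
        ∑' j : ℕ, eulerTerm q q (2 * j + 1) / (1 - q ^ (2 * j + 1)) =
      ∑' n : ℕ, (-1) ^ n * q ^ ((n + 1) ^ 2) / oddProd q (n + 1) := by
  rw [← tsum_congr (sum_antidiagonal_oddTerm hq),
    ← tsum_prod_eq_tsum_antidiagonal (summable_oddTerm hq), ← tsum_mul_left]
  refine tsum_congr fun j => ?_
  have h1 : ‖-q ^ (2 * (j + 1) + 1)‖ < 1 := by
    rw [norm_neg, norm_pow]; exact pow_lt_one₀ (norm_nonneg _) hq (by omega)
  have h2 := (multipliable_one_sub_odd_pow hq (j + 1)).prod_mul_tprod_nat_mul'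
    (f := fun k => 1 - q ^ (2 * k + 1))
  have h3 : ∏' k : ℕ, (1 - q ^ (2 * (k + (j + 1)) + 1)) =
      ∑' s, eulerTerm (q ^ 2) (-q ^ (2 * (j + 1) + 1)) s := by
    rw [← tprod_one_add_mul_pow (norm_sq_lt_one hq) h1]
    exact tprod_congr fun k => by ring
  have h4 : j * (2 * j + 1) = (2 * j + 1).choose 2 := by
    nlinarith [two_mul_choose_two_add (2 * j + 1)]
  simp only [oddTerm]
  rw [tsum_mul_left, ← h2, h3, ← oddProd, eulerTerm, ← h4, eulerProd_succ, eulerProd_two_mul,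
    oddProd_succ]
  have a1 := oddProd_ne_zero hq j
  have a2 := eulerProd_ne_zero (norm_sq_lt_one hq) j
  have a3 := one_sub_pow_succ_ne_zero hq (2 * j)
  field_simp
  ring

theorem sums_of_tails_sigma (q : ℂ) (hq : ‖q‖ < 1) :
    ∑' n : ℕ, (1 / ∏ k ∈ range n, (1 + q ^ (k + 1)) - 1 / ∏' k : ℕ, (1 + q ^ (k + 1))) =
      2 * ∑' n : ℕ, (-1 : ℂ) ^ n * q ^ ((n + 1) ^ 2) / ∏ k ∈ range (n + 1), (1 - q ^ (2 * k + 1))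
        - (1 / ∏' k : ℕ, (1 + q ^ (k + 1))) * ∑' n : ℕ, q ^ (n + 1) / (1 - q ^ (n + 1)) := by
  have euler := tprod_one_add_pow_mul_tprod_one_sub_odd_pow hq
  have hP : ∏' k : ℕ, (1 + q ^ (k + 1)) ≠ 0 := left_ne_zero_of_mul_eq_one euler
  have hP' : ∏' k : ℕ, (1 - q ^ (2 * k + 1)) = 1 / ∏' k : ℕ, (1 + q ^ (k + 1)) := by
    rw [eq_div_iff hP, mul_comm, euler]
  have tail (n : ℕ) : 1 / ∏ k ∈ range n, (1 + q ^ (k + 1)) - 1 / ∏' k : ℕ, (1 + q ^ (k + 1)) =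
      1 / (∏' k : ℕ, (1 + q ^ (k + 1))) * (∏' k : ℕ, (1 + q ^ (n + 1) * q ^ k) - 1) := by
    have e (k : ℕ) : 1 + q ^ (n + 1) * q ^ k = 1 + q ^ (k + n + 1) := by ring
    have h := Multipliable.prod_mul_tprod_nat_mul' (f := fun k => 1 + q ^ (k + 1)) (k := n)
      ((multipliable_one_add_mul_pow hq (q ^ (n + 1))).congr e)
    simp only [e]
    rw [← h] at hP ⊢
    have := left_ne_zero_of_mul hP
    have := right_ne_zero_of_mul hP
    field_simp
  have su := summable_eulerTerm_div hq
  have su' : Summable fun k : ℕ => (-1) ^ k * (eulerTerm q q (k + 1) / (1 - q ^ (k + 1))) :=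
    .of_norm_bounded su.norm fun k => by simp
  have sum_eq : ∑' k, eulerTerm q q (k + 1) / (1 - q ^ (k + 1)) +
      ∑' k : ℕ, (-1) ^ k * (eulerTerm q q (k + 1) / (1 - q ^ (k + 1))) =
      2 * ∑' j : ℕ, eulerTerm q q (2 * j + 1) / (1 - q ^ (2 * j + 1)) := by
    rw [← su.tsum_add su', ← tsum_mul_left]
    have he : HasSum (fun j : ℕ => 2 * (eulerTerm q q (2 * j + 1) / (1 - q ^ (2 * j + 1)))) _ :=
      ((su.comp_injective (mul_right_injective₀ (two_ne_zero' ℕ))).mul_left 2).hasSum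
    refine (HasSum.even_add_odd (f := fun k => _) (he.congr_fun fun j => ?_)
      (hasSum_zero.congr_fun fun j => ?_)).tsum_eq.trans (add_zero _)
    · simp [pow_mul]
      ring
    · simp [pow_succ, pow_mul]
  rw [tsum_congr tail, tsum_mul_left, tsum_tprod_sub_one hq, tsum_lambert hq]
  have main := tsum_eulerTerm_div_even hq
  simp only [oddProd] at main
  rw [← main, hP', eq_sub_iff_add_eq, ← mul_add, sum_eq]
  ring
end

section
/- (Ramanujan, Lost Notebook Entry 1.7.2) For |q| < 1 and complex a, b (with b ≠ 0 and denominators nonvanishing): Σ_{n≥0} ((−aq/b;q)_n b^n (−1)^n q^{n(n+1)/2})/(−b;q)_{n+1} = Σ_{n≥0} ((−b)^n (−q;q)_n (−aq/b;q)_n)/(aq;q^2)_{n+1}, assuming both series converge absolutely. -/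
open Finset

/-- The general term of `∑ ∏ (b - x q ^ k) (-q; q)_n / (x; q ^ 2)_{n + 1}`. -/
noncomputable def quadraticTerm (q b x : ℂ) (n : ℕ) : ℂ :=
  (∏ k ∈ range n, (b - x * q ^ k)) * (∏ k ∈ range n, (1 + q ^ (k + 1))) /
    ∏ k ∈ range (n + 1), (1 - x * q ^ (2 * k))

lemma quadraticTerm_succ (q b x : ℂ) (n : ℕ) :
    quadraticTerm q b x (n + 1) =
      (b - x * q ^ n) * (1 + q ^ (n + 1)) / (1 - x * q ^ (2 * (n + 1))) *
        quadraticTerm q b x n := by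
  unfold quadraticTerm
  rw [prod_range_succ _ n, prod_range_succ _ n, prod_range_succ _ (n + 1), div_mul_div_comm]
  congr 1 <;> ring

lemma tendsto_pow_comp_of_norm_lt_one {q : ℂ} (hq : ‖q‖ < 1) {f : ℕ → ℕ} (hf : ∀ n, n ≤ f n) :
    Filter.Tendsto (fun n => q ^ f n) Filter.atTop (nhds 0) :=
  (tendsto_pow_atTop_nhds_zero_of_norm_lt_one hq).comp
    (Filter.tendsto_atTop_mono hf Filter.tendsto_id)

lemma summable_quadraticTerm {q b : ℂ} (x : ℂ) (hq : ‖q‖ < 1) (hb : ‖b‖ < 1) :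
    Summable (quadraticTerm q b x) := by
  obtain ⟨r, hbr, hr⟩ := exists_between hb
  have hlim : Filter.Tendsto
      (fun n : ℕ => (b - x * q ^ n) * (1 + q ^ (n + 1)) / (1 - x * q ^ (2 * (n + 1))))
      Filter.atTop (nhds ((b - x * 0) * (1 + 0) / (1 - x * 0))) := by
    refine Filter.Tendsto.div (Filter.Tendsto.mul ?_ ?_) ?_ (by simp)
    · exact tendsto_const_nhds.sub
        ((tendsto_pow_comp_of_norm_lt_one hq fun n => le_refl n).const_mul x)
    · exact tendsto_const_nhds.add (tendsto_pow_comp_of_norm_lt_one hq fun n => by omega)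
    · exact tendsto_const_nhds.sub
        ((tendsto_pow_comp_of_norm_lt_one hq fun n => by omega).const_mul x)
  refine summable_of_ratio_norm_eventually_le hr ?_
  have hlt : ‖(b - x * 0) * (1 + 0) / (1 - x * 0)‖ < r := by simpa using hbr
  filter_upwards [hlim.norm.eventually_lt_const hlt] with n hn
  rw [quadraticTerm_succ, norm_mul]
  gcongr

lemma quadraticTerm_shift {q b x : ℂ} (hx : ∀ k : ℕ, 1 - x * q ^ (2 * k) ≠ 0) (n : ℕ) :
    (1 - x * q ^ (n + 1)) * quadraticTerm q b x (n + 1) =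
      q * (b - x) * quadraticTerm q (b * q) (x * q ^ 2) n +
        (b - x * q ^ n) * quadraticTerm q b x n := by
  have hP : (b - x) * ∏ k ∈ range n, (b * q - x * q ^ 2 * q ^ k) =
      q ^ n * ((∏ k ∈ range n, (b - x * q ^ k)) * (b - x * q ^ n)) := by
    rw [← prod_range_succ, prod_range_succ']
    have : ∏ k ∈ range n, (b * q - x * q ^ 2 * q ^ k) =
        q ^ n * ∏ k ∈ range n, (b - x * q ^ (k + 1)) := by
      rw [← card_range n, ← prod_const, card_range, ← prod_mul_distrib]
      exact prod_congr rfl fun k _ => by ring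
    rw [this]
    ring
  have hD : (1 - x) * ∏ k ∈ range (n + 1), (1 - x * q ^ 2 * q ^ (2 * k)) =
      (∏ k ∈ range (n + 1), (1 - x * q ^ (2 * k))) * (1 - x * q ^ (2 * (n + 1))) := by
    rw [← prod_range_succ, prod_range_succ' _ (n + 1), mul_comm]
    congr 1
    · exact prod_congr rfl fun k _ => by ring
    · simp
  have hx0 : 1 - x ≠ 0 := by simpa using hx 0
  have hQ : ∏ k ∈ range (n + 1), (1 - x * q ^ (2 * k)) ≠ 0 := prod_ne_zero_iff.2 fun k _ => hx k
  have hshift : (b - x) * quadraticTerm q (b * q) (x * q ^ 2) n =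
      q ^ n * (1 - x) * (b - x * q ^ n) / (1 - x * q ^ (2 * (n + 1))) * quadraticTerm q b x n := by
    have hD' := eq_div_of_mul_eq hx0 ((mul_comm _ _).trans hD)
    unfold quadraticTerm
    rw [hD', mul_div_assoc, ← mul_assoc, hP]
    have := hx (n + 1)
    field_simp
  rw [mul_assoc q, hshift, quadraticTerm_succ]
  have := hx (n + 1)
  field_simp
  ring

lemma tsum_quadraticTerm_shift {q b x : ℂ} (hq : ‖q‖ < 1) (hb : ‖b‖ < 1)
    (hx : ∀ k : ℕ, 1 - x * q ^ (2 * k) ≠ 0) :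
    (1 - b) * ∑' n, quadraticTerm q b x n =
      1 + q * (b - x) * ∑' n, quadraticTerm q (b * q) (x * q ^ 2) n := by
  have hR := summable_quadraticTerm x hq hb
  have hbq : ‖b * q‖ < 1 := by
    rw [norm_mul]
    exact mul_lt_one_of_nonneg_of_lt_one_left (norm_nonneg _) hb hq.le
  have hS := summable_quadraticTerm (x * q ^ 2) hq hbq
  have hV : Summable fun n => x * q ^ n * quadraticTerm q b x n := by
    refine Summable.of_norm_bounded (hR.norm.mul_left ‖x‖) fun n => ?_
    rw [norm_mul, norm_mul, norm_pow]
    gcongr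
    exact mul_le_of_le_one_right (norm_nonneg _) (pow_le_one₀ (norm_nonneg _) hq.le)
  have h0 : (1 - x) * quadraticTerm q b x 0 = 1 := by
    have hx0 : 1 - x ≠ 0 := by simpa using hx 0
    simp [quadraticTerm, hx0]
  have hsum : ∑' n, (quadraticTerm q b x (n + 1) - x * q ^ (n + 1) * quadraticTerm q b x (n + 1)) =
      ∑' n, (q * (b - x) * quadraticTerm q (b * q) (x * q ^ 2) n +
        (b * quadraticTerm q b x n - x * q ^ n * quadraticTerm q b x n)) :=
    tsum_congr fun n => by linear_combination quadraticTerm_shift (b := b) hx n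
  rw [((summable_nat_add_iff 1).2 hR).tsum_sub ((summable_nat_add_iff 1).2 hV),
    (hS.mul_left _).tsum_add ((hR.mul_left b).sub hV), (hR.mul_left b).tsum_sub hV,
    tsum_mul_left, tsum_mul_left] at hsum
  have hR0 := hR.tsum_eq_zero_add
  have hV0 := hV.tsum_eq_zero_add
  simp only [pow_zero, mul_one] at hV0
  linear_combination hsum + hR0 - hV0 + h0

/-- The general term of `∑ ∏ (b - x q ^ k) q ^ (n (n + 1) / 2) / (b; q)_{n + 1}`. -/
noncomputable def gaussianTerm (q b x : ℂ) (n : ℕ) : ℂ :=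
  (∏ k ∈ range n, (b - x * q ^ k)) * q ^ (n * (n + 1) / 2) / ∏ k ∈ range (n + 1), (1 - b * q ^ k)

lemma tsum_quadraticTerm_eq_sum_add {q b x : ℂ} (hq : ‖q‖ < 1) (hb : ‖b‖ < 1)
    (hbk : ∀ k : ℕ, 1 - b * q ^ k ≠ 0) (hx : ∀ k : ℕ, 1 - x * q ^ (2 * k) ≠ 0) (N : ℕ) :
    ∑' n, quadraticTerm q b x n = ∑ n ∈ range N, gaussianTerm q b x n +
      gaussianTerm q b x N * (1 - b * q ^ N) *
        ∑' n, quadraticTerm q (b * q ^ N) (x * q ^ (2 * N)) n := by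
  induction N with
  | zero =>
    have := hbk 0
    simp only [pow_zero, mul_one] at this
    simp [gaussianTerm, this]
  | succ N ih =>
    have hbN : ‖b * q ^ N‖ < 1 := by
      rw [norm_mul, norm_pow]
      exact mul_lt_one_of_nonneg_of_lt_one_left (norm_nonneg _) hb
        (pow_le_one₀ (norm_nonneg _) hq.le)
    have hxN : ∀ k : ℕ, 1 - x * q ^ (2 * N) * q ^ (2 * k) ≠ 0 := fun k => by
      have := hx (N + k)
      rwa [mul_add, pow_add, ← mul_assoc] at this
    have hF := tsum_quadraticTerm_shift hq hbN hxN
    have hterm : gaussianTerm q b x (N + 1) * (1 - b * q ^ (N + 1)) =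
        gaussianTerm q b x N * (q * (b * q ^ N - x * q ^ (2 * N))) := by
      have hexp : (N + 1) * (N + 1 + 1) / 2 = N * (N + 1) / 2 + (N + 1) := by
        rw [show (N + 1) * (N + 1 + 1) = N * (N + 1) + (N + 1) * 2 by ring,
          Nat.add_mul_div_right _ _ two_pos]
      have hQ : ∏ k ∈ range (N + 1), (1 - b * q ^ k) ≠ 0 := prod_ne_zero_iff.2 fun k _ => hbk k
      have := hbk (N + 1)
      unfold gaussianTerm
      rw [hexp, prod_range_succ _ N, prod_range_succ _ (N + 1)]
      field_simp
      ring
    rw [sum_range_succ, ih, hterm, mul_assoc, hF,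
      show b * q ^ (N + 1) = b * q ^ N * q by ring,
      show x * q ^ (2 * (N + 1)) = x * q ^ (2 * N) * q ^ 2 by ring]
    ring

lemma norm_tsum_quadraticTerm_le {q b x : ℂ} (hq : ‖q‖ ≤ 1) (hb : ‖b‖ ≤ 1 / 16)
    (hx : ‖x‖ ≤ 1 / 16) : ‖∑' n, quadraticTerm q b x n‖ ≤ 4 := by
  have hpow (k : ℕ) : ‖q ^ k‖ ≤ 1 := by
    rw [norm_pow]
    exact pow_le_one₀ (norm_nonneg _) hq
  have hxpow (k : ℕ) : ‖x * q ^ k‖ ≤ 1 / 16 := by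
    rw [norm_mul]
    exact (mul_le_of_le_one_right (norm_nonneg _) (hpow k)).trans hx
  have hden (k : ℕ) : 1 / 2 ≤ ‖1 - x * q ^ k‖ := by
    have := norm_sub_norm_le 1 (x * q ^ k)
    rw [norm_one] at this
    linarith [hxpow k]
  have hbound (n : ℕ) : ‖quadraticTerm q b x n‖ ≤ 2 * (1 / 2) ^ n := by
    induction n with
    | zero =>
      have := hden 0
      simp only [quadraticTerm, range_zero, prod_empty, mul_one, zero_add, range_one,
        prod_singleton, mul_zero, norm_div, norm_one, pow_zero] at this ⊢
      rw [div_le_iff₀ (by linarith)]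
      linarith
    | succ n ih =>
      rw [quadraticTerm_succ, norm_mul, pow_succ (1 / 2 : ℝ)]
      have hratio : ‖(b - x * q ^ n) * (1 + q ^ (n + 1)) / (1 - x * q ^ (2 * (n + 1)))‖ ≤
          1 / 2 := by
        have hnum : ‖b - x * q ^ n‖ ≤ 1 / 8 :=
          (norm_sub_le _ _).trans (by linarith [hxpow n])
        have hone : ‖1 + q ^ (n + 1)‖ ≤ 2 :=
          (norm_add_le _ _).trans (by rw [norm_one]; linarith [hpow (n + 1)])
        have := hden (2 * (n + 1))
        rw [norm_div, norm_mul, div_le_iff₀ (by linarith)]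
        nlinarith [norm_nonneg (b - x * q ^ n), norm_nonneg (1 + q ^ (n + 1))]
      calc _ ≤ 1 / 2 * (2 * (1 / 2 : ℝ) ^ n) := by gcongr
        _ = _ := by ring
  have hgeom := hasSum_geometric_two.mul_left 2
  norm_num at hgeom
  exact tsum_of_norm_bounded hgeom (fun n => by simpa using hbound n)

theorem tsum_gaussianTerm_eq_tsum_quadraticTerm {q b x : ℂ} (hq : ‖q‖ < 1) (hb : ‖b‖ < 1)
    (hbk : ∀ k : ℕ, 1 - b * q ^ k ≠ 0) (hx : ∀ k : ℕ, 1 - x * q ^ (2 * k) ≠ 0)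
    (hs : Summable (gaussianTerm q b x)) :
    ∑' n, gaussianTerm q b x n = ∑' n, quadraticTerm q b x n := by
  have hbN : Filter.Tendsto (fun N : ℕ => b * q ^ N) Filter.atTop (nhds 0) := by
    simpa using (tendsto_pow_comp_of_norm_lt_one hq fun n => le_refl n).const_mul b
  have hxN : Filter.Tendsto (fun N : ℕ => x * q ^ (2 * N)) Filter.atTop (nhds 0) := by
    simpa using (tendsto_pow_comp_of_norm_lt_one (f := fun n => 2 * n) hq
      fun n => by omega).const_mul x
  have hcoef : Filter.Tendsto (fun N : ℕ => gaussianTerm q b x N * (1 - b * q ^ N))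
      Filter.atTop (nhds 0) := by
    simpa using hs.tendsto_atTop_zero.mul (hbN.const_sub 1)
  have hrem : Filter.Tendsto (fun N : ℕ => gaussianTerm q b x N * (1 - b * q ^ N) *
      ∑' n, quadraticTerm q (b * q ^ N) (x * q ^ (2 * N)) n) Filter.atTop (nhds 0) := by
    refine hcoef.zero_mul_isBoundedUnder_le (Filter.isBoundedUnder_of_eventually_le (a := 4) ?_)
    have h16 : ‖(0 : ℂ)‖ < 1 / 16 := by norm_num
    filter_upwards [hbN.norm.eventually_lt_const h16, hxN.norm.eventually_lt_const h16]
      with N h₁ h₂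
    exact norm_tsum_quadraticTerm_le hq.le h₁.le h₂.le
  have hlim := hs.hasSum.tendsto_sum_nat.add hrem
  simp only [← tsum_quadraticTerm_eq_sum_add hq hb hbk hx, add_zero] at hlim
  exact tendsto_nhds_unique hlim tendsto_const_nhds

theorem ramanujan_entry_1_7_2 (q a b : ℂ) (hq : ‖q‖ < 1) (hb0 : b ≠ 0) (hb : ‖b‖ < 1)
    (hden1 : ∀ n : ℕ, (∏ k ∈ range (n + 1), (1 + b * q ^ k)) ≠ 0)
    (hden2 : ∀ n : ℕ, (∏ k ∈ range (n + 1), (1 - a * q ^ (2 * k + 1))) ≠ 0)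
    (h1 : Summable fun n : ℕ =>
      (∏ k ∈ range n, (1 + (a * q / b) * q ^ k)) * b ^ n * (-1 : ℂ) ^ n *
        q ^ (n * (n + 1) / 2) / ∏ k ∈ range (n + 1), (1 + b * q ^ k))
    (h2 : Summable fun n : ℕ =>
      (-b) ^ n * (∏ k ∈ range n, (1 + q ^ (k + 1))) *
        (∏ k ∈ range n, (1 + (a * q / b) * q ^ k)) /
          ∏ k ∈ range (n + 1), (1 - a * q ^ (2 * k + 1))) :
    ∑' n : ℕ, (∏ k ∈ range n, (1 + (a * q / b) * q ^ k)) * b ^ n * (-1 : ℂ) ^ n *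
        q ^ (n * (n + 1) / 2) / ∏ k ∈ range (n + 1), (1 + b * q ^ k) =
      ∑' n : ℕ, (-b) ^ n * (∏ k ∈ range n, (1 + q ^ (k + 1))) *
        (∏ k ∈ range n, (1 + (a * q / b) * q ^ k)) /
          ∏ k ∈ range (n + 1), (1 - a * q ^ (2 * k + 1)) := by
  have hprod (n : ℕ) : ∏ k ∈ range n, (-b - a * q * q ^ k) =
      (-b) ^ n * ∏ k ∈ range n, (1 + (a * q / b) * q ^ k) := by
    rw [← card_range n, ← prod_const, card_range, ← prod_mul_distrib]
    refine prod_congr rfl fun k _ => ?_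
    field_simp
    ring
  have hG (n : ℕ) : (∏ k ∈ range n, (1 + (a * q / b) * q ^ k)) * b ^ n * (-1 : ℂ) ^ n *
      q ^ (n * (n + 1) / 2) / ∏ k ∈ range (n + 1), (1 + b * q ^ k) =
        gaussianTerm q (-b) (a * q) n := by
    simp only [gaussianTerm, hprod, neg_mul, sub_neg_eq_add]
    rw [neg_pow b]
    ring
  have hR (n : ℕ) : (-b) ^ n * (∏ k ∈ range n, (1 + q ^ (k + 1))) *
      (∏ k ∈ range n, (1 + (a * q / b) * q ^ k)) /
        ∏ k ∈ range (n + 1), (1 - a * q ^ (2 * k + 1)) = quadraticTerm q (-b) (a * q) n := by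
    have hpow (k : ℕ) : a * q ^ (2 * k + 1) = a * q * q ^ (2 * k) := by ring
    simp only [quadraticTerm, hprod, hpow]
    ring
  simp only [hG, hR] at h1 ⊢
  refine tsum_gaussianTerm_eq_tsum_quadraticTerm hq (by rwa [norm_neg]) (fun k => ?_)
    (fun k => ?_) h1
  · rw [neg_mul, sub_neg_eq_add]
    exact prod_ne_zero_iff.1 (hden1 k) k (self_mem_range_succ k)
  · have := prod_ne_zero_iff.1 (hden2 k) k (self_mem_range_succ k)
    rwa [pow_succ', ← mul_assoc] at this
end

section
/- (Corson–Favero–Liesinger–Zubairy W1 double-sum identity) For |q| < 1, Σ_{n≥0} ((q;q)_n (−1)^n q^{n(n+1)/2})/(−q;q)_n = Σ_{n≥0} Σ_{|j|≤n} (−1)^{n+j} q^{2n^2+n−j^2} (1 − q^{2n+1}). -/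
open Finset

/-- The `q`-Pochhammer symbol `(a; q)_n`. -/
noncomputable def qPoch (a q : ℂ) (n : ℕ) : ℂ := ∏ k ∈ range n, (1 - a * q ^ k)

@[simp] lemma qPoch_zero (a q : ℂ) : qPoch a q 0 = 1 := by simp [qPoch]

lemma qPoch_succ (a q : ℂ) (n : ℕ) : qPoch a q (n + 1) = qPoch a q n * (1 - a * q ^ n) :=
  prod_range_succ _ _

lemma one_sub_mul_pow_ne_zero {a q : ℂ} (ha : ‖a‖ < 1) (hq : ‖q‖ < 1) (n : ℕ) :
    1 - a * q ^ n ≠ 0 := by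
  intro h
  have h1 : ‖a * q ^ n‖ < 1 := by
    rw [norm_mul, norm_pow]
    exact mul_lt_one_of_nonneg_of_lt_one_left (norm_nonneg _) ha (pow_le_one₀ (norm_nonneg _) hq.le)
  rw [← sub_eq_zero.mp h] at h1
  simp at h1

lemma qPoch_ne_zero {a q : ℂ} (ha : ‖a‖ < 1) (hq : ‖q‖ < 1) (n : ℕ) : qPoch a q n ≠ 0 :=
  prod_ne_zero_iff.mpr fun k _ => one_sub_mul_pow_ne_zero ha hq k

lemma exists_tendsto_qPoch {a q : ℂ} (ha : ‖a‖ < 1) (hq : ‖q‖ < 1) :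
    ∃ L ≠ 0, Filter.Tendsto (qPoch a q) Filter.atTop (nhds L) := by
  have hs : Summable fun k : ℕ => ‖-(a * q ^ k)‖ := by
    simpa [norm_mul, norm_pow] using
      (summable_geometric_of_lt_one (norm_nonneg q) hq).mul_left ‖a‖
  refine ⟨∏' k : ℕ, (1 + -(a * q ^ k)), tprod_one_add_ne_zero_of_summable ?_ hs, ?_⟩
  · intro k
    simpa [sub_eq_add_neg] using one_sub_mul_pow_ne_zero ha hq k
  · have h := (multipliable_one_add_of_summable hs).tendsto_prod_tprod_nat
    simpa only [← sub_eq_add_neg] using! h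

lemma exists_norm_qPoch_le {a q : ℂ} (ha : ‖a‖ < 1) (hq : ‖q‖ < 1) :
    ∃ C, ∀ n, ‖qPoch a q n‖ ≤ C ∧ ‖(qPoch a q n)⁻¹‖ ≤ C := by
  obtain ⟨L, hL, h⟩ := exists_tendsto_qPoch ha hq
  obtain ⟨C₁, h₁⟩ := isBounded_iff_forall_norm_le.mp (Metric.isBounded_range_of_tendsto _ h)
  obtain ⟨C₂, h₂⟩ :=
    isBounded_iff_forall_norm_le.mp (Metric.isBounded_range_of_tendsto _ (h.inv₀ hL))
  exact ⟨max C₁ C₂, fun n => ⟨(h₁ _ ⟨n, rfl⟩).trans (le_max_left _ _),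
    (h₂ _ ⟨n, rfl⟩).trans (le_max_right _ _)⟩⟩

lemma choose_two_succ (n : ℕ) : (n + 1).choose 2 = n.choose 2 + n := by
  rw [Nat.choose_succ_succ' n 1, Nat.choose_one_right, add_comm]

/-! ### The limiting very-well-poised sum -/

/-- The summand of a limiting case of the `₆φ₅` sum. -/
noncomputable def wellPoisedTerm (q : ℂ) (j m : ℕ) : ℂ :=
  q ^ (m * m + j * m) * (1 - q ^ (2 * (j + m) + 1)) * qPoch q q (2 * j + m) / qPoch q q m

/-- The certificate for the recurrence in `j` satisfied by `wellPoisedTerm`. -/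
noncomputable def wellPoisedCert (q : ℂ) (j m : ℕ) : ℂ :=
  q ^ (m * m + j * m) * (qPoch q q (2 * j + m) / qPoch q q m * (1 - q ^ m) *
    (1 - q ^ (j + 1) - q ^ (j + 1) * q ^ m + q ^ (3 * j + 2) * (q ^ m) ^ 2))

lemma wellPoisedTerm_succ_sub {q : ℂ} (hq : ‖q‖ < 1) (j m : ℕ) :
    wellPoisedTerm q (j + 1) m - (1 - q ^ (j + 1)) * wellPoisedTerm q j m =
      wellPoisedCert q j (m + 1) - wellPoisedCert q j m := by
  have hP := qPoch_ne_zero hq hq m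
  have h1 := one_sub_mul_pow_ne_zero hq hq m
  unfold wellPoisedTerm wellPoisedCert
  rw [show 2 * (j + 1) + m = 2 * j + m + 1 + 1 by ring, ← add_assoc (2 * j) m 1]
  simp only [qPoch_succ]
  field_simp
  ring

lemma exists_norm_wellPoisedTerm_le {q : ℂ} (hq : ‖q‖ < 1) :
    ∃ C, ∀ j m, ‖wellPoisedTerm q j m‖ ≤ C * ‖q‖ ^ m := by
  obtain ⟨C, hC⟩ := exists_norm_qPoch_le hq hq
  have hC0 : 0 ≤ C := (norm_nonneg _).trans (hC 0).1
  refine ⟨2 * C * C, fun j m => ?_⟩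
  have h1 : ‖q ^ (m * m + j * m)‖ ≤ ‖q‖ ^ m := by
    rw [norm_pow]
    exact pow_le_pow_of_le_one (norm_nonneg _) hq.le (by nlinarith [Nat.le_mul_self m])
  have h2 : ‖1 - q ^ (2 * (j + m) + 1)‖ ≤ 2 := by
    refine (norm_sub_le _ _).trans ?_
    rw [norm_one, norm_pow]
    linarith [pow_le_one₀ (n := 2 * (j + m) + 1) (norm_nonneg q) hq.le]
  unfold wellPoisedTerm
  rw [div_eq_mul_inv, norm_mul, norm_mul, norm_mul]
  calc _ ≤ ‖q‖ ^ m * 2 * C * C := by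
        gcongr
        · exact (hC _).1
        · exact (hC _).2
    _ = _ := by ring

lemma summable_wellPoisedTerm {q : ℂ} (hq : ‖q‖ < 1) (j : ℕ) :
    Summable (wellPoisedTerm q j) := by
  obtain ⟨C, hC⟩ := exists_norm_wellPoisedTerm_le hq
  exact Summable.of_norm_bounded
    ((summable_geometric_of_lt_one (norm_nonneg q) hq).mul_left C) (hC j)

lemma tendsto_wellPoisedCert {q : ℂ} (hq : ‖q‖ < 1) (j : ℕ) :
    Filter.Tendsto (wellPoisedCert q j) Filter.atTop (nhds 0) := by
  obtain ⟨L, hL, h⟩ := exists_tendsto_qPoch hq hq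
  have hpow := tendsto_pow_atTop_nhds_zero_of_norm_lt_one hq
  have h1 : Filter.Tendsto (fun m : ℕ => q ^ (m * m + j * m)) Filter.atTop (nhds 0) :=
    hpow.comp (Filter.tendsto_atTop_mono
      (fun m => show m ≤ m * m + j * m by nlinarith [Nat.le_mul_self m]) Filter.tendsto_id)
  have h2 : Filter.Tendsto (fun m : ℕ => qPoch q q (2 * j + m)) Filter.atTop (nhds L) :=
    h.comp (Filter.tendsto_atTop_mono (fun m => show m ≤ 2 * j + m by omega) Filter.tendsto_id)
  have h3 := h1.mul (((h2.div h hL).mul (hpow.const_sub 1)).mul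
    (((hpow.const_mul (q ^ (j + 1))).const_sub (1 - q ^ (j + 1))).add
      ((hpow.pow 2).const_mul (q ^ (3 * j + 2)))))
  rw [zero_mul] at h3
  exact h3

lemma tsum_eq_zero_of_telescoping {f g : ℕ → ℂ} (hf : Summable f)
    (hfg : ∀ m, f m = g (m + 1) - g m) (hg0 : g 0 = 0)
    (hg : Filter.Tendsto g Filter.atTop (nhds 0)) : ∑' m, f m = 0 := by
  refine tendsto_nhds_unique hf.hasSum.tendsto_sum_nat ?_
  simpa only [hfg, sum_range_sub, hg0, sub_zero] using hg

lemma tsum_wellPoisedTerm {q : ℂ} (hq : ‖q‖ < 1) (j : ℕ) :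
    ∑' m, wellPoisedTerm q j m = qPoch q q j := by
  induction j with
  | zero =>
    have hs := summable_wellPoisedTerm hq 0
    have hpow : Filter.Tendsto (fun m : ℕ => q ^ (m * m)) Filter.atTop (nhds 0) :=
      (tendsto_pow_atTop_nhds_zero_of_norm_lt_one hq).comp
        (Filter.tendsto_atTop_mono Nat.le_mul_self Filter.tendsto_id)
    refine tendsto_nhds_unique hs.hasSum.tendsto_sum_nat ?_
    have h (m : ℕ) : wellPoisedTerm q 0 m = -q ^ ((m + 1) * (m + 1)) - -q ^ (m * m) := by
      have hP := qPoch_ne_zero hq hq m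
      unfold wellPoisedTerm
      rw [mul_zero, zero_add, mul_div_assoc, div_self hP]
      ring
    simp only [h, sum_range_sub (fun m : ℕ => -q ^ (m * m))]
    simpa using hpow.neg.sub_const (-1)
  | succ j ih =>
    have h1 := summable_wellPoisedTerm hq (j + 1)
    have h2 := (summable_wellPoisedTerm hq j).mul_left (1 - q ^ (j + 1))
    have h := tsum_eq_zero_of_telescoping (h1.sub h2) (wellPoisedTerm_succ_sub hq j)
      (by simp [wellPoisedCert]) (tendsto_wellPoisedCert hq j)
    rw [h1.tsum_sub h2, tsum_mul_left, ih] at h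
    rw [sub_eq_zero.mp h, qPoch_succ, pow_succ']
    ring

/-! ### The inverted Bailey pair -/

/-- The summand, at `n = j + k`, expressing `α_n` in terms of `β_j = 1 / (-q; q)_j`. -/
noncomputable def baileyTerm (q : ℂ) (j k : ℕ) : ℂ :=
  (-1) ^ k * q ^ k.choose 2 * qPoch q q (2 * j + k) / (qPoch q q k * qPoch (-q) q j)

/-- The certificate for the recurrence in `n` satisfied by the sums of `baileyTerm`. -/
noncomputable def baileyCert (q : ℂ) (j k : ℕ) : ℂ :=
  -((-1) ^ k * q ^ (k + 1).choose 2 * (1 + q ^ j) * (1 - q ^ (j + k)) *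
    qPoch q q (2 * j + k - 1) / (qPoch q q k * qPoch (-q) q j))

lemma baileyTerm_succ_sub {q : ℂ} (hq : ‖q‖ < 1) (j k : ℕ) :
    baileyTerm q j (k + 1) - q ^ (3 * (j + k) + 2) * baileyTerm q j k =
      baileyCert q (j + 1) k - baileyCert q j (k + 1) := by
  have hq' : ‖-q‖ < 1 := by rwa [norm_neg]
  have hP := qPoch_ne_zero hq hq k
  have hQ := qPoch_ne_zero hq' hq j
  have h1 := one_sub_mul_pow_ne_zero hq hq k
  have h2 : 1 + q * q ^ j ≠ 0 := by simpa using one_sub_mul_pow_ne_zero hq' hq j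
  unfold baileyTerm baileyCert
  rw [show 2 * (j + 1) + k - 1 = 2 * j + k + 1 by omega,
    show 2 * j + (k + 1) - 1 = 2 * j + k by omega, ← add_assoc (2 * j) k 1]
  simp only [qPoch_succ, choose_two_succ, neg_mul, sub_neg_eq_add]
  field_simp
  ring

/-- The sum of `baileyTerm` over `j + k = n`. -/
noncomputable def baileySum (q : ℂ) (n : ℕ) : ℂ := ∑ p ∈ antidiagonal n, baileyTerm q p.1 p.2

lemma baileySum_succ {q : ℂ} (hq : ‖q‖ < 1) (n : ℕ) :
    baileySum q (n + 1) =
      q ^ (3 * n + 2) * baileySum q n + 2 * (-1) ^ (n + 1) * q ^ (n + 2).choose 2 := by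
  have h1 := Nat.sum_antidiagonal_succ (n := n) (f := fun p => baileyCert q p.1 p.2)
  have h2 := Nat.sum_antidiagonal_succ' (n := n) (f := fun p => baileyCert q p.1 p.2)
  have h3 := Nat.sum_antidiagonal_succ' (n := n) (f := fun p => baileyTerm q p.1 p.2)
  have h4 : ∑ p ∈ antidiagonal n, baileyTerm q p.1 (p.2 + 1) - q ^ (3 * n + 2) * baileySum q n =
      ∑ p ∈ antidiagonal n, baileyCert q (p.1 + 1) p.2 -
        ∑ p ∈ antidiagonal n, baileyCert q p.1 (p.2 + 1) := by
    rw [baileySum, mul_sum, ← sum_sub_distrib, ← sum_sub_distrib]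
    refine sum_congr rfl fun p hp => ?_
    rw [← baileyTerm_succ_sub hq, mem_antidiagonal.mp hp]
  have h5 : baileyTerm q (n + 1) 0 = -baileyCert q (n + 1) 0 := by
    unfold baileyTerm baileyCert
    rw [show 2 * (n + 1) + 0 - 1 = 2 * n + 1 by omega,
      show 2 * (n + 1) + 0 = 2 * n + 1 + 1 by omega, qPoch_succ _ _ (2 * n + 1)]
    simp
    ring
  have h6 : baileyCert q 0 (n + 1) = -(2 * (-1) ^ (n + 1) * q ^ (n + 2).choose 2) := by
    have hP := qPoch_ne_zero hq hq n
    have h1 := one_sub_mul_pow_ne_zero hq hq n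
    unfold baileyCert
    rw [show 2 * 0 + (n + 1) - 1 = n by omega, qPoch_succ, qPoch_zero]
    field_simp
    ring
  rw [baileySum]
  simp only at h1 h2 h3
  linear_combination h3 + h4 + h5 - h1 + h2 - h6

lemma sum_Icc_eq_baileySum {q : ℂ} (hq : ‖q‖ < 1) (n : ℕ) :
    ∑ j ∈ Icc (-(n : ℤ)) (n : ℤ), (-1 : ℂ) ^ ((n : ℤ) + j) * q ^ (2 * (n : ℤ) ^ 2 + n - j ^ 2) =
      (-1) ^ n * q ^ (n + 1).choose 2 * baileySum q n := by
  induction n with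
  | zero => simp [baileySum, baileyTerm]
  | succ n ih =>
    have hI : Icc (-((n + 1 : ℕ) : ℤ)) ((n + 1 : ℕ) : ℤ) =
        insert (-((n + 1 : ℕ) : ℤ)) (insert ((n + 1 : ℕ) : ℤ) (Icc (-(n : ℤ)) (n : ℤ))) := by
      ext j
      simp only [mem_insert, mem_Icc]
      omega
    have hS : ∑ j ∈ Icc (-(n : ℤ)) (n : ℤ), (-1 : ℂ) ^ (((n + 1 : ℕ) : ℤ) + j) *
          q ^ (2 * ((n + 1 : ℕ) : ℤ) ^ 2 + ((n + 1 : ℕ) : ℤ) - j ^ 2) =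
        -q ^ (4 * n + 3) * ∑ j ∈ Icc (-(n : ℤ)) (n : ℤ),
          (-1 : ℂ) ^ ((n : ℤ) + j) * q ^ (2 * (n : ℤ) ^ 2 + n - j ^ 2) := by
      rw [mul_sum]
      refine sum_congr rfl fun j hj => ?_
      rw [mem_Icc] at hj
      have hj2 : j ^ 2 ≤ (n : ℤ) ^ 2 := sq_le_sq' hj.1 hj.2
      rw [show ((n + 1 : ℕ) : ℤ) + j = (n + j) + 1 by push_cast; ring,
        show 2 * ((n + 1 : ℕ) : ℤ) ^ 2 + ((n + 1 : ℕ) : ℤ) - j ^ 2 =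
          ((4 * n + 3 : ℕ) : ℤ) + (2 * (n : ℤ) ^ 2 + n - j ^ 2) by push_cast; ring,
        zpow_add_one₀ (by norm_num), zpow_add' (a := q) (Or.inr (Or.inl ?_)), zpow_natCast]
      · ring
      · push_cast
        nlinarith
    have hE : 2 * ((n + 1 : ℕ) : ℤ) ^ 2 + ((n + 1 : ℕ) : ℤ) - ((n + 1 : ℕ) : ℤ) ^ 2 =
        (((n + 2).choose 2 + (n + 2).choose 2 : ℕ) : ℤ) := by
      have h2 : (n + 2).choose 2 * 2 = (n + 2) * (n + 1) := by
        rw [Nat.choose_two_right]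
        exact Nat.div_mul_cancel (Nat.even_mul_pred_self (n + 2)).two_dvd
      zify at h2
      push_cast
      linarith
    rw [hI, sum_insert, sum_insert, hS, ih, baileySum_succ hq]
    · rw [add_neg_cancel, neg_sq, hE, zpow_natCast, zpow_zero, ← Nat.cast_add, zpow_natCast,
        Even.neg_one_pow ⟨n + 1, rfl⟩]
      rw [choose_two_succ (n + 1)]
      ring_nf
      rw [show ((-1 : ℂ)) ^ (n * 2) = 1 by simp [pow_mul']]
      ring
    · simp
    · simp only [mem_insert, mem_Icc]
      omega

lemma choose_two_add (j k : ℕ) :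
    (j + k + 1).choose 2 + k.choose 2 = (j + 1).choose 2 + (k * k + j * k) := by
  induction k with
  | zero => simp
  | succ k ih =>
    rw [← add_assoc, choose_two_succ (j + k + 1), choose_two_succ k]
    linarith

theorem CFLZ_W1_double_sum (q : ℂ) (hq : ‖q‖ < 1) :
    ∑' n : ℕ, (∏ k ∈ range n, (1 - q ^ (k + 1))) * (-1 : ℂ) ^ n * q ^ (n * (n + 1) / 2) /
        ∏ k ∈ range n, (1 + q ^ (k + 1)) =
      ∑' n : ℕ, ∑ j ∈ Finset.Icc (-(n : ℤ)) (n : ℤ),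
        (-1 : ℂ) ^ ((n : ℤ) + j) * q ^ (2 * (n : ℤ) ^ 2 + n - j ^ 2) * (1 - q ^ (2 * n + 1)) := by
  have hq' : ‖-q‖ < 1 := by rwa [norm_neg]
  set c : ℕ → ℂ := fun j => (-1) ^ j * q ^ (j + 1).choose 2 * (qPoch (-q) q j)⁻¹ with hc
  have hsum : Summable fun p : ℕ × ℕ => c p.1 * wellPoisedTerm q p.1 p.2 := by
    obtain ⟨C, hC⟩ := exists_norm_wellPoisedTerm_le hq
    obtain ⟨B, hB⟩ := exists_norm_qPoch_le hq' hq
    have hg := summable_geometric_of_lt_one (norm_nonneg q) hq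
    have hB0 : 0 ≤ B := (norm_nonneg _).trans (hB 0).1
    have hc_le (j : ℕ) : ‖c j‖ ≤ B * ‖q‖ ^ j := by
      rw [hc, norm_mul, norm_mul, norm_pow, norm_neg, norm_one, one_pow, one_mul, norm_pow,
        mul_comm]
      have h := pow_le_pow_of_le_one (norm_nonneg q) hq.le
        (show j ≤ (j + 1).choose 2 by rw [choose_two_succ]; omega)
      exact mul_le_mul (hB j).2 h (by positivity) hB0
    refine Summable.of_norm_bounded ((hg.mul_left B).mul_of_nonneg (hg.mul_left C)
      (fun j => by positivity) fun m => (norm_nonneg _).trans (hC 0 m)) fun p => ?_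
    rw [norm_mul]
    exact mul_le_mul (hc_le _) (hC _ _) (norm_nonneg _) (by positivity)
  have hP (n : ℕ) : ∏ k ∈ range n, (1 - q ^ (k + 1)) = qPoch q q n := by
    simp only [qPoch, pow_succ']
  have hQ (n : ℕ) : ∏ k ∈ range n, (1 + q ^ (k + 1)) = qPoch (-q) q n := by
    simp only [qPoch, pow_succ', neg_mul, sub_neg_eq_add]
  have hL (n : ℕ) : (∏ k ∈ range n, (1 - q ^ (k + 1))) * (-1 : ℂ) ^ n * q ^ (n * (n + 1) / 2) /
      ∏ k ∈ range n, (1 + q ^ (k + 1)) = ∑' m, c n * wellPoisedTerm q n m := by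
    rw [tsum_mul_left, tsum_wellPoisedTerm hq, hP, hQ, mul_comm n (n + 1),
      show (n + 1) * n / 2 = (n + 1).choose 2 by rw [Nat.choose_two_right, Nat.add_sub_cancel]]
    ring
  have hR (n : ℕ) : ∑ j ∈ Finset.Icc (-(n : ℤ)) (n : ℤ),
      (-1 : ℂ) ^ ((n : ℤ) + j) * q ^ (2 * (n : ℤ) ^ 2 + n - j ^ 2) * (1 - q ^ (2 * n + 1)) =
      ∑ p ∈ antidiagonal n, c p.1 * wellPoisedTerm q p.1 p.2 := by
    rw [← sum_mul, sum_Icc_eq_baileySum hq, baileySum, mul_sum, sum_mul]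
    refine sum_congr rfl fun p hp => ?_
    obtain ⟨j, k⟩ := p
    obtain rfl : j + k = n := mem_antidiagonal.mp hp
    have hpow : q ^ (j + k + 1).choose 2 * q ^ k.choose 2 =
        q ^ (j + 1).choose 2 * q ^ (k * k + j * k) := by rw [← pow_add, choose_two_add, pow_add]
    have hsign : (-1 : ℂ) ^ (j + k) * (-1) ^ k = (-1) ^ j := by
      rw [pow_add, mul_assoc, ← mul_pow]; simp
    simp only [hc, baileyTerm, wellPoisedTerm, div_eq_mul_inv, mul_inv]
    calc _ = ((-1 : ℂ) ^ (j + k) * (-1) ^ k) * (q ^ (j + k + 1).choose 2 * q ^ k.choose 2) *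
          (qPoch q q (2 * j + k) * ((qPoch q q k)⁻¹ * (qPoch (-q) q j)⁻¹) *
            (1 - q ^ (2 * (j + k) + 1))) := by ring
      _ = _ := by rw [hsign, hpow]; ring
  simp only [hL, hR]
  rw [← hsum.tsum_prod, ← HasAntidiagonal.sigmaAntidiagonalEquivProd.tsum_eq]
  have hsig := HasAntidiagonal.sigmaAntidiagonalEquivProd.summable_iff.mpr hsum
  refine (Summable.tsum_sigma' (fun n => (hasSum_fintype _).summable) hsig).trans ?_
  refine tsum_congr fun n => ?_
  rw [tsum_fintype]
  exact sum_coe_sort (antidiagonal n) fun p => c p.1 * wellPoisedTerm q p.1 p.2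
end

section
/- For |q| < 1, the series L(q) := Σ_{n≥1} q^n (q^2;q^2)_{n−1}/(−q^2;q^2)_n satisfies L(−q) = Σ_{n≥1} ((q;q)_{n−1} (−1)^n q^{n(n+1)/2})/(−q;q)_n, i.e. L(−q) = LL(q). -/
open Finset

/-- Ratio test for a sequence given by its successive quotients. -/
lemma summable_of_succ_eq_mul_of_tendsto {f g : ℕ → ℂ} {l : ℂ} (hfg : ∀ n, f (n + 1) = f n * g n)
    (hg : Filter.Tendsto g Filter.atTop (nhds l)) (hl : ‖l‖ < 1) : Summable f := by
  obtain ⟨r, hlr, hr⟩ := exists_between hl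
  refine summable_of_ratio_norm_eventually_le hr ?_
  filter_upwards [hg.norm.eventually_le_const hlr] with n hn
  rw [hfg, norm_mul, mul_comm]
  gcongr

lemma one_add_pow_ne_zero {q : ℂ} (hq : ‖q‖ < 1) {n : ℕ} (hn : n ≠ 0) : 1 + q ^ n ≠ 0 := by
  intro h
  have h' : ‖q ^ n‖ = 1 := by rw [eq_neg_of_add_eq_zero_right h]; simp
  exact (pow_lt_one₀ (norm_nonneg q) hq hn).ne (by rw [← norm_pow, h'])

lemma tendsto_pow_comp {q : ℂ} (hq : ‖q‖ < 1) {u : ℕ → ℕ} (hu : StrictMono u) :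
    Filter.Tendsto (fun n => q ^ u n) Filter.atTop (nhds 0) :=
  (tendsto_pow_atTop_nhds_zero_of_norm_lt_one hq).comp hu.tendsto_atTop

/-- The summand of Fine's function `F(a, b; t) = ∑ (aq; q)_n t ^ n / (bq; q)_n`. -/
noncomputable def fineTerm (q a b t : ℂ) (n : ℕ) : ℂ :=
  t ^ n * ∏ k ∈ range n, ((1 - a * q ^ (k + 1)) / (1 - b * q ^ (k + 1)))

/-- Fine's function `F(a, b; t) = ∑ (aq; q)_n t ^ n / (bq; q)_n`. -/
noncomputable def fine (q a b t : ℂ) : ℂ := ∑' n, fineTerm q a b t n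

lemma fineTerm_succ (q a b t : ℂ) (n : ℕ) :
    fineTerm q a b t (n + 1) =
      fineTerm q a b t n * (t * ((1 - a * q ^ (n + 1)) / (1 - b * q ^ (n + 1)))) := by
  simp only [fineTerm, prod_range_succ]
  ring

lemma fineTerm_shift (q a b t : ℂ) (n : ℕ) :
    q ^ (n + 1) * fineTerm q a b t (n + 1) =
      t * q * ((1 - a * q) / (1 - b * q)) * fineTerm q (a * q) (b * q) (t * q) n := by
  simp only [fineTerm, prod_range_succ', mul_pow]
  simp only [mul_assoc, ← pow_succ', zero_add, pow_one]
  ring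

lemma summable_fineTerm {q t : ℂ} (hq : ‖q‖ < 1) (ht : ‖t‖ < 1) (a b : ℂ) :
    Summable (fineTerm q a b t) := by
  refine summable_of_succ_eq_mul_of_tendsto (fineTerm_succ q a b t) (l := t) ?_ ht
  have h := tendsto_pow_comp hq (u := fun n => n + 1) (fun _ _ h => Nat.succ_lt_succ h)
  have := ((h.const_mul a).const_sub 1).div ((h.const_mul b).const_sub 1) (by simp)
  simpa using this.const_mul t

/-- The recurrence whose iteration yields the Rogers–Fine identity. -/
lemma fine_eq {q t : ℂ} (hq : ‖q‖ < 1) (ht : ‖t‖ < 1) (a b : ℂ)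
    (hb : ∀ n : ℕ, 1 - b * q ^ (n + 1) ≠ 0) :
    (1 - t) * fine q a b t = 1 - a * t * q +
      (b - a * t * q) * (t * q * ((1 - a * q) / (1 - b * q))) *
        fine q (a * q) (b * q) (t * q) := by
  have hs := summable_fineTerm hq ht a b
  have htq : ‖t * q‖ < 1 := by
    rw [norm_mul]; exact mul_lt_one_of_nonneg_of_lt_one_left (norm_nonneg t) ht hq.le
  have hs' := summable_fineTerm hq htq (a * q) (b * q)
  set d : ℕ → ℂ := fun n => fineTerm q a b t n * (1 - a * t * q ^ (n + 1)) with hd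
  have hd0 : Filter.Tendsto d Filter.atTop (nhds 0) := by
    have h := tendsto_pow_comp hq (u := fun n => n + 1) (fun _ _ h => Nat.succ_lt_succ h)
    simpa using hs.tendsto_atTop_zero.mul ((h.const_mul (a * t)).const_sub 1)
  have key : ∀ n, (1 - t) * fineTerm q a b t n -
      (b - a * t * q) * (t * q * ((1 - a * q) / (1 - b * q))) *
        fineTerm q (a * q) (b * q) (t * q) n = d n - d (n + 1) := by
    intro n
    have h1 : fineTerm q a b t (n + 1) * (1 - b * q ^ (n + 1)) =
        fineTerm q a b t n * (t * (1 - a * q ^ (n + 1))) := by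
      rw [fineTerm_succ, mul_assoc, mul_assoc, div_mul_cancel₀ _ (hb n)]
    rw [mul_assoc, ← fineTerm_shift]
    simp only [hd]
    linear_combination h1
  have hsum := (hs.hasSum.mul_left (1 - t)).sub
    (hs'.hasSum.mul_left ((b - a * t * q) * (t * q * ((1 - a * q) / (1 - b * q)))))
  have hlim := hsum.tendsto_sum_nat
  simp only [key, sum_range_sub'] at hlim
  have h := tendsto_nhds_unique hlim (hd0.const_sub (d 0))
  have hd1 : d 0 = 1 - a * t * q := by simp [hd, fineTerm]
  rw [hd1] at h
  simp only [fine]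
  linear_combination h

lemma norm_fine_le {q a b t : ℂ} (hq : ‖q‖ < 1) (ha : ‖a‖ ≤ 1) (hb : ‖b‖ ≤ 1 / 2)
    (ht : ‖t‖ ≤ 1 / 8) : ‖fine q a b t‖ ≤ 2 := by
  have hterm : ∀ n, ‖fineTerm q a b t n‖ ≤ (1 / 2 : ℝ) ^ n := by
    intro n
    induction n with
    | zero => simp [fineTerm]
    | succ n ih =>
      have hqn : ‖q ^ (n + 1)‖ ≤ 1 := by
        rw [norm_pow]; exact pow_le_one₀ (norm_nonneg q) hq.le
      have h1 : ‖1 - a * q ^ (n + 1)‖ ≤ 2 := by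
        refine (norm_sub_le _ _).trans ?_
        rw [norm_one, norm_mul]
        linarith [mul_le_one₀ ha (norm_nonneg _) hqn]
      have h2 : 1 / 2 ≤ ‖1 - b * q ^ (n + 1)‖ := by
        have := norm_sub_norm_le 1 (b * q ^ (n + 1))
        rw [norm_one, norm_mul] at this
        linarith [mul_le_of_le_one_right (norm_nonneg b) hqn]
      rw [fineTerm_succ, norm_mul, norm_mul, norm_div, pow_succ (1 / 2 : ℝ)]
      gcongr
      calc ‖t‖ * (‖1 - a * q ^ (n + 1)‖ / ‖1 - b * q ^ (n + 1)‖) ≤ 1 / 8 * (2 / (1 / 2)) := by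
            gcongr
        _ = 1 / 2 := by norm_num
  exact tsum_of_norm_bounded hasSum_geometric_two hterm

/-- The coefficient of the remainder after `m` steps of the Rogers–Fine iteration. -/
noncomputable def rogersFineWeight (q : ℂ) (m : ℕ) : ℂ :=
  q ^ (2 * m ^ 2 + 3 * m) * (1 + q ^ (2 * m + 1)) * (∏ k ∈ range (2 * m), (1 - q ^ (k + 1))) /
    ∏ k ∈ range (2 * m + 2), (1 + q ^ (k + 1))

lemma prod_one_add_pow_ne_zero {q : ℂ} (hq : ‖q‖ < 1) (n : ℕ) :
    ∏ k ∈ range n, (1 + q ^ (k + 1)) ≠ 0 :=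
  prod_ne_zero_iff.2 fun k _ => one_add_pow_ne_zero hq k.succ_ne_zero

lemma rogersFineWeight_succ {q : ℂ} (hq : ‖q‖ < 1) (m : ℕ) :
    rogersFineWeight q (m + 1) = rogersFineWeight q m *
      (q ^ (4 * m + 5) * (1 - q ^ (2 * m + 1)) * (1 - q ^ (2 * m + 2)) /
        ((1 + q ^ (2 * m + 1)) * (1 + q ^ (2 * m + 4)))) := by
  have h0 := prod_one_add_pow_ne_zero hq (2 * m)
  have h1 := one_add_pow_ne_zero hq (n := 2 * m + 1) (by omega)
  have h2 := one_add_pow_ne_zero hq (n := 2 * m + 2) (by omega)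
  have h3 := one_add_pow_ne_zero hq (n := 2 * m + 3) (by omega)
  have h4 := one_add_pow_ne_zero hq (n := 2 * m + 4) (by omega)
  have e : 2 * (m + 1) ^ 2 + 3 * (m + 1) = (2 * m ^ 2 + 3 * m) + (4 * m + 5) := by ring
  have e' : 2 * (m + 1) = 2 * m + 1 + 1 := by ring
  rw [rogersFineWeight, rogersFineWeight, e, pow_add q (2 * m ^ 2 + 3 * m), e']
  simp only [prod_range_succ]
  simp only [add_assoc (2 * m), Nat.reduceAdd]
  generalize ∏ k ∈ range (2 * m), (1 + q ^ (k + 1)) = D at *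
  generalize 1 + q ^ (2 * m + 1) = x1 at *
  generalize 1 + q ^ (2 * m + 2) = x2 at *
  generalize 1 + q ^ (2 * m + 3) = x3 at *
  generalize 1 + q ^ (2 * m + 4) = x4 at *
  field_simp

lemma tendsto_rogersFineWeight {q : ℂ} (hq : ‖q‖ < 1) :
    Filter.Tendsto (rogersFineWeight q) Filter.atTop (nhds 0) := by
  refine (summable_of_succ_eq_mul_of_tendsto (rogersFineWeight_succ hq) (l := 0) ?_
    (by simp)).tendsto_atTop_zero
  have h5 := tendsto_pow_comp hq (u := fun m => 4 * m + 5) (fun _ _ h => by dsimp only; omega)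
  have h1 := tendsto_pow_comp hq (u := fun m => 2 * m + 1) (fun _ _ h => by dsimp only; omega)
  have h2 := tendsto_pow_comp hq (u := fun m => 2 * m + 2) (fun _ _ h => by dsimp only; omega)
  have h4 := tendsto_pow_comp hq (u := fun m => 2 * m + 4) (fun _ _ h => by dsimp only; omega)
  simpa [Pi.div_def] using ((h5.mul (h1.const_sub 1)).mul (h2.const_sub 1)).div
    ((h1.const_add 1).mul (h4.const_add 1)) (by simp)

/-- The remainder after `m` steps of the Rogers–Fine iteration. -/
noncomputable def rogersFineRemainder (q : ℂ) (m : ℕ) : ℂ :=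
  rogersFineWeight q m * fine (q ^ 2) (q ^ (2 * m)) (-q ^ (2 * m + 2)) (-q ^ (2 * m + 1))

lemma rogersFineRemainder_sub_succ {q : ℂ} (hq : ‖q‖ < 1) (m : ℕ) :
    rogersFineRemainder q m - rogersFineRemainder q (m + 1) =
      rogersFineWeight q m * ((1 + q ^ (4 * m + 3)) / (1 + q ^ (2 * m + 1))) := by
  have hq2 : ‖q ^ 2‖ < 1 := by
    rw [norm_pow]; exact pow_lt_one₀ (norm_nonneg q) hq two_ne_zero
  have ht : ‖-q ^ (2 * m + 1)‖ < 1 := by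
    rw [norm_neg, norm_pow]; exact pow_lt_one₀ (norm_nonneg q) hq (by omega)
  have h1 := one_add_pow_ne_zero hq (n := 2 * m + 1) (by omega)
  have h4 := one_add_pow_ne_zero hq (n := 2 * m + 4) (by omega)
  have h := fine_eq hq2 ht (q ^ (2 * m)) (-q ^ (2 * m + 2)) (fun n => by
    have := one_add_pow_ne_zero hq (n := 2 * m + 2 + 2 * (n + 1)) (by omega)
    rwa [neg_mul, sub_neg_eq_add, ← pow_mul, ← pow_add])
  have ea : q ^ (2 * m) * q ^ 2 = q ^ (2 * (m + 1)) := by ring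
  have eb : -q ^ (2 * m + 2) * q ^ 2 = -q ^ (2 * (m + 1) + 2) := by ring
  have et : -q ^ (2 * m + 1) * q ^ 2 = -q ^ (2 * (m + 1) + 1) := by ring
  have eb' : 1 - -q ^ (2 * (m + 1) + 2) = 1 + q ^ (2 * m + 4) := by ring
  rw [ea, eb, et, eb', sub_neg_eq_add] at h
  simp only [rogersFineRemainder, rogersFineWeight_succ hq m]
  generalize fine (q ^ 2) (q ^ (2 * (m + 1))) (-q ^ (2 * (m + 1) + 2))
    (-q ^ (2 * (m + 1) + 1)) = G' at *
  generalize fine (q ^ 2) (q ^ (2 * m)) (-q ^ (2 * m + 2)) (-q ^ (2 * m + 1)) = G at *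
  have hG : G = (1 + q ^ (4 * m + 3)) / (1 + q ^ (2 * m + 1)) +
      q ^ (4 * m + 5) * (1 - q ^ (2 * m + 1)) * (1 - q ^ (2 * m + 2)) /
        ((1 + q ^ (2 * m + 1)) * (1 + q ^ (2 * m + 4))) * G' := by
    apply mul_left_cancel₀ h1
    rw [h]
    field_simp
    ring
  rw [hG]
  ring

lemma tendsto_rogersFineRemainder {q : ℂ} (hq : ‖q‖ < 1) :
    Filter.Tendsto (rogersFineRemainder q) Filter.atTop (nhds 0) := by
  have hq2 : ‖q ^ 2‖ < 1 := by
    rw [norm_pow]; exact pow_lt_one₀ (norm_nonneg q) hq two_ne_zero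
  have h1 := (tendsto_pow_comp hq (u := fun m => 2 * m + 1)
    (fun _ _ h => by dsimp only; omega)).norm
  have h2 := (tendsto_pow_comp hq (u := fun m => 2 * m + 2)
    (fun _ _ h => by dsimp only; omega)).norm
  rw [norm_zero] at h1 h2
  refine squeeze_zero_norm' (a := fun m => ‖rogersFineWeight q m‖ * 2) ?_
    (by simpa using (tendsto_rogersFineWeight hq).norm.mul_const 2)
  filter_upwards [h1.eventually_le_const (by norm_num : (0 : ℝ) < 1 / 8),
    h2.eventually_le_const (by norm_num : (0 : ℝ) < 1 / 2)] with m hm1 hm2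
  rw [rogersFineRemainder, norm_mul]
  gcongr
  refine norm_fine_le hq2 ?_ (by rwa [norm_neg]) (by rwa [norm_neg])
  rw [norm_pow]
  exact pow_le_one₀ (norm_nonneg q) hq.le

/-- The summand of the series `LL`. -/
noncomputable def LLTerm (q : ℂ) (n : ℕ) : ℂ :=
  (∏ k ∈ range n, (1 - q ^ (k + 1))) * (-1 : ℂ) ^ (n + 1) *
    q ^ ((n + 1) * (n + 2) / 2) / ∏ k ∈ range (n + 1), (1 + q ^ (k + 1))

lemma LLTerm_succ (q : ℂ) (n : ℕ) :
    LLTerm q (n + 1) =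
      LLTerm q n * (-(q ^ (n + 2) * (1 - q ^ (n + 1)) / (1 + q ^ (n + 2)))) := by
  have e : (n + 1 + 1) * (n + 1 + 2) / 2 = (n + 1) * (n + 2) / 2 + (n + 2) := by
    rw [← Nat.add_mul_div_right _ _ two_pos]
    congr 1
    ring
  simp only [LLTerm, e, prod_range_succ _ (n + 1), prod_range_succ (fun k => 1 - q ^ (k + 1)) n,
    add_assoc, Nat.reduceAdd]
  rw [← add_assoc n 1 1, pow_add q (_ / 2), pow_succ (-1 : ℂ) (n + 1)]
  simp only [div_eq_mul_inv, mul_inv]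
  ring

lemma summable_LLTerm {q : ℂ} (hq : ‖q‖ < 1) : Summable (LLTerm q) := by
  refine summable_of_succ_eq_mul_of_tendsto (LLTerm_succ q) (l := 0) ?_ (by simp)
  have h1 := tendsto_pow_comp hq (u := fun n => n + 1) (fun _ _ h => by dsimp only; omega)
  have h2 := tendsto_pow_comp hq (u := fun n => n + 2) (fun _ _ h => by dsimp only; omega)
  simpa using ((h2.mul (h1.const_sub 1)).div (h2.const_add 1) (by simp)).neg

lemma LLTerm_add_LLTerm {q : ℂ} (hq : ‖q‖ < 1) (m : ℕ) :
    LLTerm q (2 * m) + LLTerm q (2 * m + 1) =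
      -q * (rogersFineWeight q m * ((1 + q ^ (4 * m + 3)) / (1 + q ^ (2 * m + 1)))) := by
  have h0 := prod_one_add_pow_ne_zero hq (2 * m)
  have h1 := one_add_pow_ne_zero hq (n := 2 * m + 1) (by omega)
  have h2 := one_add_pow_ne_zero hq (n := 2 * m + 2) (by omega)
  have e : (2 * m + 1) * (2 * m + 2) / 2 = 2 * m ^ 2 + 3 * m + 1 := by
    apply Nat.div_eq_of_eq_mul_left two_pos
    ring
  have es : (-1 : ℂ) ^ (2 * m + 1) = -1 := by simp [pow_succ, pow_mul]
  rw [LLTerm_succ]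
  simp only [LLTerm, rogersFineWeight, e, es, prod_range_succ _ (2 * m),
    prod_range_succ _ (2 * m + 1)]
  simp only [add_assoc, Nat.reduceAdd]
  field_simp
  ring

lemma sum_LLTerm {q : ℂ} (hq : ‖q‖ < 1) (m : ℕ) :
    ∑ n ∈ range (2 * m), LLTerm q n =
      -q * (rogersFineRemainder q 0 - rogersFineRemainder q m) := by
  induction m with
  | zero => simp
  | succ m ih =>
    rw [mul_add, mul_one, sum_range_succ, sum_range_succ, ih, add_assoc, LLTerm_add_LLTerm hq,
      ← rogersFineRemainder_sub_succ hq]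
    ring

lemma tsum_LLTerm {q : ℂ} (hq : ‖q‖ < 1) : ∑' n, LLTerm q n = -q * rogersFineRemainder q 0 := by
  have h := (summable_LLTerm hq).hasSum.tendsto_sum_nat.comp
    (show StrictMono fun m : ℕ => 2 * m from fun _ _ h => by dsimp only; omega).tendsto_atTop
  have h' := ((tendsto_rogersFineRemainder hq).const_sub (rogersFineRemainder q 0)).const_mul (-q)
  rw [sub_zero] at h'
  refine tendsto_nhds_unique h (h'.congr fun m => ?_)
  simp [sum_LLTerm hq m]

theorem L_neg_q_eq_LL (q : ℂ) (hq : ‖q‖ < 1) :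
    ∑' n : ℕ, (-q) ^ (n + 1) * (∏ k ∈ range n, (1 - (-q) ^ (2 * (k + 1)))) /
        ∏ k ∈ range (n + 1), (1 + (-q) ^ (2 * (k + 1))) =
      ∑' n : ℕ, (∏ k ∈ range n, (1 - q ^ (k + 1))) * (-1 : ℂ) ^ (n + 1) *
        q ^ ((n + 1) * (n + 2) / 2) / ∏ k ∈ range (n + 1), (1 + q ^ (k + 1)) := by
  refine Eq.trans ?_ (tsum_LLTerm hq).symm
  have hW : rogersFineWeight q 0 = 1 / (1 + q ^ 2) := by
    have h1 := one_add_pow_ne_zero hq one_ne_zero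
    rw [pow_one] at h1
    simp only [rogersFineWeight, prod_range_succ, mul_zero, range_zero, prod_empty]
    norm_num
    field_simp
  rw [rogersFineRemainder, hW, fine, ← mul_assoc, ← tsum_mul_left]
  refine tsum_congr fun n => ?_
  have e : ∀ k : ℕ, 1 - -q ^ (2 * 0 + 2) * (q ^ 2) ^ (k + 1) = 1 + q ^ (2 * (k + 1 + 1)) := by
    intro k; ring
  simp only [fineTerm, prod_div_distrib, e, prod_range_succ' _ n, (even_two_mul _).neg_pow]
  simp only [mul_zero, pow_zero, one_mul, zero_add, mul_one, pow_one, ← pow_mul, div_eq_mul_inv, mul_inv]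
  ring
end
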